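/- arXiv:1809.00067 — 5 statements merged into one kernel-verified Lean document; each statement's English description precedes it below -/
import Mathlib

section
/- For every element x of 𝔄 one has x³·x³ = x²·(x²·x²) and x³·x³ = x·(x·(x²·x²)) (that is, x³x³ equals the third principal power of x² and equals x(x(x²x²))). -/
/-- Linear and quadratic parts (in `y`) of the linearization of `x⁴ = 0`. -/
theorem lin_aux {F A : Type*} [Field F] [NonUnitalNonAssocRing A]
    [Module F A]
    (h2 : (2 : F) ≠ 0) (h3 : (3 : F) ≠ 0)
    (hx4 : ∀ x : A, x * (x * (x * x)) = 0) (x y : A) :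
    y * (x * (x * x)) + x * (y * (x * x)) + x * (x * (y * x)) + x * (x * (x * y)) = 0 ∧
    y * (y * (x * x)) + y * (x * (y * x)) + y * (x * (x * y)) + x * (y * (y * x))
      + x * (y * (x * y)) + x * (x * (y * y)) = 0 := by
  have d2 : ∀ a : A, (2 : ℤ) • a = 0 → a = 0 := by
    intro a h
    have h' : (2 : F) • a = 0 := by
      rw [two_smul]; rwa [two_zsmul] at h
    exact (smul_eq_zero.mp h').resolve_left h2
  have d3 : ∀ a : A, (3 : ℤ) • a = 0 → a = 0 := by
    intro a h
    have h' : (3 : F) • a = 0 := by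
      have e : (3 : F) • a = (3 : ℤ) • a := by
        rw [← Int.cast_smul_eq_zsmul F]; norm_num
      rw [e, h]
    exact (smul_eq_zero.mp h').resolve_left h3
  have e0 := hx4 x
  have ey := hx4 y
  have e1 := hx4 (x + y)
  have e2 := hx4 (x - y)
  have e3 := hx4 (x + (y + y))
  simp only [mul_add, add_mul, mul_sub, sub_mul, e0, ey] at e1 e2 e3
  have hQ : y * (y * (x * x)) + y * (x * (y * x)) + y * (x * (x * y)) + x * (y * (y * x))
      + x * (y * (x * y)) + x * (x * (y * y)) = 0 := by
    apply d2
    have e4 := congrArg₂ (fun s t => s + t) e1 e2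
    simp only [add_zero, zero_add] at e4
    rw [← e4]
    abel
  refine ⟨?_, hQ⟩
  apply d2
  apply d3
  have e4 := congrArg (fun t => (8 : ℤ) • t) e1
  have e5 := congrArg (fun t => (4 : ℤ) • t) hQ
  have e6 := congrArg₂ (fun s t => s - t) (congrArg₂ (fun s t => s - t) e4 e3) e5
  simp only [smul_zero, add_zero, zero_add, sub_zero] at e6
  rw [← e6]
  abel

/-- 𝔄 is a commutative (not necessarily associative) algebra over a field `F` of
characteristic ≠ 2, 3, satisfying the identity `x⁴ = 0` (principal powers:
`x¹ = x`, `x^(k+1) = x * x^k`). -/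
theorem stmt_1 {F A : Type*} [Field F] [NonUnitalNonAssocRing A]
    [Module F A] [SMulCommClass F A A] [IsScalarTower F A A]
    (hcomm : ∀ a b : A, a * b = b * a)
    (h2 : (2 : F) ≠ 0) (h3 : (3 : F) ≠ 0)
    (hx4 : ∀ x : A, x * (x * (x * x)) = 0)
    (x : A) :
    (x * (x * x)) * (x * (x * x)) = (x * x) * ((x * x) * (x * x)) ∧
      (x * (x * x)) * (x * (x * x)) = x * (x * ((x * x) * (x * x))) := by
  have a1 := (lin_aux h2 h3 hx4 x (x * x)).1
  have a2 := (lin_aux h2 h3 hx4 x (x * (x * x))).1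
  have a3 := (lin_aux h2 h3 hx4 x (x * x)).2
  rw [hcomm (x * x) x] at a1 a3
  rw [hcomm (x * (x * x)) x, hcomm (x * (x * x)) (x * x)] at a2
  simp only [hx4, mul_zero, add_zero] at a1 a2 a3
  have a4 : (x * x) * (x * (x * x)) = - (x * ((x * x) * (x * x))) :=
    eq_neg_of_add_eq_zero_left a1
  simp only [a4, mul_neg] at a2 a3
  have h : (x * (x * x)) * (x * (x * x)) = x * (x * ((x * x) * (x * x))) := by
    rw [← sub_eq_zero, sub_eq_add_neg]; exact a2
  refine ⟨?_, h⟩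
  rw [h, eq_comm, ← sub_eq_zero, ← a3]
  abel
end

section
/- For every x ∈ 𝔄 the degree-7 multiplication operator identity ULU² = 2UL²UL - 2UL³U - 2LUL²U - 2L²ULU - 8LUL⁴ - 2L²UL³ - 3L⁴UL + L⁵U holds (as an equality of operators acting on every y ∈ 𝔄). -/
/-- The full linearization of `x⁴ = 0`, divided by two. -/
theorem linearized_nil_four {F A : Type*} [Field F] [NonUnitalNonAssocRing A]
    [Module F A] [SMulCommClass F A A] [IsScalarTower F A A]
    (hcomm : ∀ a b : A, a * b = b * a) (h2 : (2 : F) ≠ 0)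
    (hx4 : ∀ x : A, x * (x * (x * x)) = 0) (a b c d : A) :
    a * (b * (c * d)) + a * (c * (b * d)) + a * (d * (b * c)) +
    (b * (a * (c * d)) + b * (c * (a * d)) + b * (d * (a * c))) +
    (c * (a * (b * d)) + c * (b * (a * d)) + c * (d * (a * b))) +
    (d * (a * (b * c)) + d * (b * (a * c)) + d * (c * (a * b))) = 0 := by
  have key : (2 : ℤ) • (a * (b * (c * d)) + a * (c * (b * d)) + a * (d * (b * c)) +
    (b * (a * (c * d)) + b * (c * (a * d)) + b * (d * (a * c))) +
    (c * (a * (b * d)) + c * (b * (a * d)) + c * (d * (a * b))) +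
    (d * (a * (b * c)) + d * (b * (a * c)) + d * (c * (a * b)))) = 0 := by
    have e1 := hx4 (a + b + c + d)
    have e2 := hx4 (a + b + c)
    have e3 := hx4 (a + b + d)
    have e4 := hx4 (a + c + d)
    have e5 := hx4 (b + c + d)
    have e6 := hx4 (a + b)
    have e7 := hx4 (a + c)
    have e8 := hx4 (a + d)
    have e9 := hx4 (b + c)
    have e10 := hx4 (b + d)
    have e11 := hx4 (c + d)
    have e12 := hx4 a
    have e13 := hx4 b
    have e14 := hx4 c
    have e15 := hx4 d
    simp only [mul_add, add_mul] at *
    simp only [hcomm d c, hcomm d b, hcomm d a, hcomm c b, hcomm c a, hcomm b a] at *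
    linear_combination (norm := skip) e1 - e2 - e3 - e4 - e5 + e6 + e7 + e8 + e9 + e10 + e11
      - e12 - e13 - e14 - e15
    abel
  have key2 : (2 : F) • (a * (b * (c * d)) + a * (c * (b * d)) + a * (d * (b * c)) +
    (b * (a * (c * d)) + b * (c * (a * d)) + b * (d * (a * c))) +
    (c * (a * (b * d)) + c * (b * (a * d)) + c * (d * (a * b))) +
    (d * (a * (b * c)) + d * (b * (a * c)) + d * (c * (a * b)))) = 0 := by
    rw [← key]; module
  exact (smul_eq_zero.mp key2).resolve_left h2

set_option maxHeartbeats 4000000 in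
/-- 𝔄 is a commutative (not necessarily associative) algebra over a field `F` of
characteristic ≠ 2, 3, satisfying the identity `x⁴ = 0` (principal powers:
`x¹ = x`, `x^(k+1) = x * x^k`). -/
theorem stmt_11 {F A : Type*} [Field F] [NonUnitalNonAssocRing A]
    [Module F A] [SMulCommClass F A A] [IsScalarTower F A A]
    (hcomm : ∀ a b : A, a * b = b * a)
    (h2 : (2 : F) ≠ 0) (h3 : (3 : F) ≠ 0)
    (hx4 : ∀ x : A, x * (x * (x * x)) = 0)
    (x y : A) :
    x * x * (x * (x * x * (x * x * (y)))) =
      (2 : ℤ) • (x * x * (x * (x * (x * x * (x * (y)))))) + ((-2 : ℤ) • (x * x * (x * (x * (x * (x * x * (y))))))) + ((-2 : ℤ) • (x * (x * x * (x * (x * (x * x * (y))))))) + ((-2 : ℤ) • (x * (x * (x * x * (x * (x * x * (y))))))) + ((-8 : ℤ) • (x * (x * x * (x * (x * (x * (x * (y)))))))) + ((-2 : ℤ) • (x * (x * (x * x * (x * (x * (x * (y)))))))) + ((-3 : ℤ) • (x * (x * (x * (x * (x * x * (x * (y)))))))) + x * (x * (x * (x * (x * (x * x * (y)))))) := by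
  have J := linearized_nil_four hcomm h2 hx4
  have W : ∀ {b : A} (a : A), b = 0 → a * b = 0 := by
    rintro b a rfl; exact mul_zero a
  have e0 := J y x x (x * (x * (x * (x * x))))
  have e1 := J y x x (x * ((x * x) * (x * x)))
  have e2 := J y x (x * x) ((x * x) * (x * x))
  have e3 := J y x (x * (x * x)) (x * (x * x))
  have e4 := J y (x * x) (x * x) (x * (x * x))
  have e5 := J x x x (x * (x * (x * (x * y))))
  have e6 := J x x x (x * (x * (y * (x * x))))
  have e7 := J x x x (y * (x * (x * (x * x))))
  have e8 := J x x x (y * ((x * x) * (x * x)))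
  have e9 := J x x x ((x * y) * (x * (x * x)))
  have e10 := J x x (x * y) (x * (x * (x * x)))
  have e11 := J x x (x * y) ((x * x) * (x * x))
  have e12 := J x x (x * x) (x * (x * (x * y)))
  have e13 := J x x (x * x) ((x * x) * (x * y))
  have e14 := J x x (x * (x * y)) (x * (x * x))
  have e15 := J x x (y * (x * x)) (x * (x * x))
  have e16 := J x (x * x) (x * x) (x * (x * y))
  have e17 := J x (x * x) (x * x) (y * (x * x))
  have e18 := J (x * y) (x * x) (x * x) (x * x)
  have e19 := W y (J x x x (x * (x * (x * x))))
  have e20 := W y (J x x x ((x * x) * (x * x)))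
  have e21 := W y (J x (x * x) (x * x) (x * x))
  have e22 := W y (W x (J x x x (x * (x * x))))
  have e23 := W y (W x (J x x (x * x) (x * x)))
  have e24 := W y (W x (W x (J x x x (x * x))))
  have e25 := W y (W x (W (x * x) (J x x x x)))
  have e26 := W y (W (x * x) (W x (J x x x x)))
  have e27 := W y (W (x * (x * x)) (J x x x x))
  have e28 := W x (J y x x (x * (x * (x * x))))
  have e29 := W x (J y x x ((x * x) * (x * x)))
  have e30 := W x (J y x (x * x) (x * (x * x)))
  have e31 := W x (J y (x * x) (x * x) (x * x))
  have e32 := W x (J x x x (x * (y * (x * x))))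
  have e33 := W x (J x x x (y * (x * (x * x))))
  have e34 := W x (J x x x ((x * x) * (x * y)))
  have e35 := W x (J x x (x * y) (x * (x * x)))
  have e36 := W x (J x x (x * x) (x * (x * y)))
  have e37 := W x (J x (x * y) (x * x) (x * x))
  have e38 := W x (W y (J x x x (x * (x * x))))
  have e39 := W x (W y (J x x (x * x) (x * x)))
  have e40 := W x (W y (W x (J x x x (x * x))))
  have e41 := W x (W x (J y x x (x * (x * x))))
  have e42 := W x (W x (J y x (x * x) (x * x)))
  have e43 := W x (W x (J x x x (x * (x * y))))
  have e44 := W x (W x (J x x x (y * (x * x))))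
  have e45 := W x (W x (J x x (x * y) (x * x)))
  have e46 := W x (W x (W y (J x x x (x * x))))
  have e47 := W x (W x (W y (W x (J x x x x))))
  have e48 := W x (W x (W x (J y x x (x * x))))
  have e49 := W x (W x (W x (J x x x (x * y))))
  have e50 := W x (W x (W x (W x (J y x x x))))
  have e51 := W x (W x (W (x * y) (J x x x x)))
  have e52 := W x (W x (W (x * x) (J y x x x)))
  have e53 := W x (W (x * y) (W x (J x x x x)))
  have e54 := W x (W (x * x) (J x x x (x * y)))
  have e55 := W x (W (x * x) (W y (J x x x x)))
  have e56 := W x (W (x * x) (W x (J y x x x)))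
  have e57 := W x (W (x * (x * y)) (J x x x x))
  have e58 := W x (W (y * (x * x)) (J x x x x))
  have e59 := W x (W (x * (x * x)) (J y x x x))
  have e60 := W (x * y) (J x x (x * x) (x * x))
  have e61 := W (x * y) (W x (J x x x (x * x)))
  have e62 := W (x * y) (W x (W x (J x x x x)))
  have e63 := W (x * x) (J y x x (x * (x * x)))
  have e64 := W (x * x) (J y x (x * x) (x * x))
  have e65 := W (x * x) (J x x x (x * (x * y)))
  have e66 := W (x * x) (J x x x (y * (x * x)))
  have e67 := W (x * x) (J x x (x * y) (x * x))
  have e68 := W (x * x) (W y (J x x x (x * x)))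
  have e69 := W (x * x) (W y (W x (J x x x x)))
  have e70 := W (x * x) (W x (J y x x (x * x)))
  have e71 := W (x * x) (W x (J x x x (x * y)))
  have e72 := W (x * x) (W x (W y (J x x x x)))
  have e73 := W (x * x) (W x (W x (J y x x x)))
  have e74 := W (x * x) (W (x * y) (J x x x x))
  have e75 := W (x * x) (W (x * x) (J y x x x))
  have e76 := W (x * (x * y)) (J x x x (x * x))
  have e77 := W (x * (x * y)) (W x (J x x x x))
  have e78 := W (y * (x * x)) (J x x x (x * x))
  have e79 := W (y * (x * x)) (W x (J x x x x))
  have e80 := W (x * (x * x)) (J y x x (x * x))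
  have e81 := W (x * (x * x)) (J x x x (x * y))
  have e82 := W (x * (x * x)) (W y (J x x x x))
  have e83 := W (x * (x * x)) (W x (J y x x x))
  have e84 := W (x * (x * (x * y))) (J x x x x)
  have e85 := W ((x * x) * (x * y)) (J x x x x)
  have e86 := W ((x * x) * (x * x)) (J y x x x)
  simp only [mul_add] at e0 e1 e2 e3 e4 e5 e6 e7 e8 e9 e10 e11 e12 e13 e14 e15 e16 e17 e18 e19 e20 e21 e22 e23 e24 e25 e26 e27 e28 e29 e30 e31 e32 e33 e34 e35 e36 e37 e38 e39 e40 e41 e42 e43 e44 e45 e46 e47 e48 e49 e50 e51 e52 e53 e54 e55 e56 e57 e58 e59 e60 e61 e62 e63 e64 e65 e66 e67 e68 e69 e70 e71 e72 e73 e74 e75 e76 e77 e78 e79 e80 e81 e82 e83 e84 e85 e86 ⊢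
  simp only [hcomm] at e0 e1 e2 e3 e4 e5 e6 e7 e8 e9 e10 e11 e12 e13 e14 e15 e16 e17 e18 e19 e20 e21 e22 e23 e24 e25 e26 e27 e28 e29 e30 e31 e32 e33 e34 e35 e36 e37 e38 e39 e40 e41 e42 e43 e44 e45 e46 e47 e48 e49 e50 e51 e52 e53 e54 e55 e56 e57 e58 e59 e60 e61 e62 e63 e64 e65 e66 e67 e68 e69 e70 e71 e72 e73 e74 e75 e76 e77 e78 e79 e80 e81 e82 e83 e84 e85 e86 ⊢
  have hN : ((2 : F) ^ 4 * 3 ^ 1) ≠ 0 := mul_ne_zero (pow_ne_zero _ h2) (pow_ne_zero _ h3)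
  have cancel : ∀ a b : A, ((2 : F) ^ 4 * 3 ^ 1) • a = ((2 : F) ^ 4 * 3 ^ 1) • b → a = b :=
    fun a b h => smul_right_injective A hN h
  apply cancel
  linear_combination (norm := skip) (-216 : F) • e0 + (-15 : F) • e1 + (6 : F) • e2 + (6 : F) • e3 + (-9 : F) • e4 + (104 : F) • e5 + (8 : F) • e6 + (-80 : F) • e7 + (-5 : F) • e8 + (12 : F) • e9 + (-48 : F) • e10 + (12 : F) • e11 + (-12 : F) • e12 + (-18 : F) • e13 + (-48 : F) • e14 + (-6 : F) • e15 + (18 : F) • e16 + (-9 : F) • e17 + (-12 : F) • e18 + (60 : F) • e19 + (1 : F) • e20 + (3 : F) • e21 + (-2 : F) • e22 + (-9 : F) • e23 + (14 : F) • e24 + (-12 : F) • e25 + (18 : F) • e26 + (-16 : F) • e27 + (108 : F) • e28 + (3 : F) • e29 + (-72 : F) • e30 + (3 : F) • e31 + (4 : F) • e32 + (-4 : F) • e33 + (40 : F) • e34 + (-12 : F) • e35 + (-48 : F) • e36 + (6 : F) • e37 + (22 : F) • e38 + (-9 : F) • e39 + (14 : F) • e40 + (78 : F) • e41 + (-30 :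 F) • e42 + (20 : F) • e43 + (2 : F) • e44 + (-36 : F) • e45 + (18 : F) • e46 + (-4 : F) • e47 + (54 : F) • e48 + (-44 : F) • e49 + (-80 : F) • e50 + (-2 : F) • e51 + (48 : F) • e52 + (46 : F) • e53 + (8 : F) • e54 + (26 : F) • e55 + (24 : F) • e56 + (6 : F) • e57 + (-8 : F) • e58 + (24 : F) • e59 + (12 : F) • e60 + (-16 : F) • e61 + (16 : F) • e62 + (-6 : F) • e63 + (30 : F) • e64 + (-8 : F) • e65 + (14 : F) • e66 + (30 : F) • e67 + (-12 : F) • e68 + (7 : F) • e69 + (-36 : F) • e70 + (-16 : F) • e71 + (7 : F) • e72 + (28 : F) • e73 + (-5 : F) • e74 + (-14 : F) • e75 + (4 : F) • e76 + (42 : F) • e77 + (8 : F) • e78 + (15 : F) • e79 + (24 : F) • e80 + (-16 : F) • e81 + (15 : F) • e82 + (-20 : F) • e83 + (10 : F) • e84 + (7 : F) • e85 + (-2 : F) • e86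
  module
end

section
/- For every a ∈ 𝔄 one has L_a^{10} = 0; that is, for all a, b ∈ 𝔄, applying left multiplication by a ten times to b gives a·(a·(a·(a·(a·(a·(a·(a·(a·(a·b))))))))) = 0. -/
set_option linter.unusedSimpArgs false

set_option maxHeartbeats 4000000 in
theorem core_ring {E : Type*} [Ring E] (L P : E)
    (hk : ∀ (K m : ℕ), K ∣ 6 ^ m → ∀ x : E, (K : ℤ) • x = 0 → x = 0)
    (Raad : - 1*(P*P*L) + 2*(P*L*L*L) - 1*(L*P*P) - 2*(L*L*L*P) - 8*(L*L*L*L*L) = 0)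
    (Racd : - 1*(P*L*P*L) - 1*(P*L*L*P) - 4*(P*L*L*L*L) - 3*(L*P*P*L) - 1*(L*P*L*P) + 4*(L*P*L*L*L) - 2*(L*L*P*P) + 2*(L*L*P*L*L) - 2*(L*L*L*L*P) = 0)
    (Rccc : 2*(P*P*P) - 2*(P*P*L*L) - 3*(P*L*P*L) + 1*(P*L*L*P) + 8*(P*L*L*L*L) - 1*(L*P*P*L) + 1*(L*P*L*P) + 8*(L*P*L*L*L) + 6*(L*L*P*L*L) + 4*(L*L*L*P*L) - 2*(L*L*L*L*P) - 16*(L*L*L*L*L*L) = 0)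
    (Race : - 12*(P*P*L*L*L) - 18*(P*L*P*L*L) - 18*(P*L*L*P*L) + 48*(P*L*L*L*L*L) - 5*(L*P*P*P) - 4*(L*P*P*L*L) - 12*(L*P*L*P*L) - 4*(L*P*L*L*P) + 28*(L*P*L*L*L*L) - 2*(L*L*P*P*L) - 4*(L*L*P*L*P) + 16*(L*L*P*L*L*L) + 12*(L*L*L*P*L*L) + 20*(L*L*L*L*P*L) + 8*(L*L*L*L*L*P) - 56*(L*L*L*L*L*L*L) = 0)
    (Radd : 1*(L*P*P*P) + 2*(L*P*P*L*L) + 6*(L*P*L*P*L) + 8*(L*P*L*L*P) + 28*(L*P*L*L*L*L) - 2*(L*L*P*P*L) + 8*(L*L*P*L*P) + 28*(L*L*P*L*L*L) + 12*(L*L*L*P*L*L) + 20*(L*L*L*L*P*L) + 20*(L*L*L*L*L*P) + 40*(L*L*L*L*L*L*L) = 0) :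
    L*L*L*L*L*L*L*L*L*L = 0 := by
  have H0 : 1*(P*P*L) - 2*(P*L*L*L) + 1*(L*P*P) + 2*(L*L*L*P) + 8*(L*L*L*L*L) = 0 := by
    refine hk 1 0 (by norm_num) _ ?_
    linear_combination (norm := noncomm_ring)
      - (1:ℤ) • (Raad)
  have H1 : 1*(P*P*P) + 2*(P*L*L*P) + 8*(P*L*L*L*L) + 2*(L*P*L*P) + 8*(L*P*L*L*L) - 2*(L*L*P*P) + 4*(L*L*L*P*L) - 8*(L*L*L*L*P) - 40*(L*L*L*L*L*L) = 0 := by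
    refine hk 2 1 (by norm_num) _ ?_
    linear_combination (norm := noncomm_ring)
      (1:ℤ) • (Rccc)
      + (2:ℤ) • (H0*(L))
      - (10:ℤ) • ((L)*H0)
      - (3:ℤ) • (Racd)
  have H2 : 1*(P*L*P*L) + 1*(P*L*L*P) + 4*(P*L*L*L*L) + 1*(L*P*L*P) + 2*(L*P*L*L*L) - 1*(L*L*P*P) - 2*(L*L*P*L*L) - 4*(L*L*L*L*P) - 24*(L*L*L*L*L*L) = 0 := by
    refine hk 1 0 (by norm_num) _ ?_
    linear_combination (norm := noncomm_ring)
      - (1:ℤ) • (Racd)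
      - (3:ℤ) • ((L)*H0)
  have H3 : 1*(P*L*P*P) - 2*(P*L*L*P*L) + 2*(P*L*L*L*P) + 2*(L*P*L*L*P) + 8*(L*P*L*L*L*L) + 2*(L*L*P*L*P) + 2*(L*L*P*L*L*L) + 3*(L*L*L*L*P*L) - 1*(L*L*L*L*L*P) = 0 := by
    refine hk 24 3 (by norm_num) _ ?_
    linear_combination (norm := noncomm_ring)
      - (24:ℤ) • (H1*(L))
      + (24:ℤ) • ((P)*H0)
      + (60:ℤ) • (H0*(L*L))
      - (60:ℤ) • ((L)*H0*(L))
      + (30:ℤ) • ((L)*H2)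
      + (1:ℤ) • (Race)
      + (18:ℤ) • (H2*(L))
      + (3:ℤ) • ((L)*H1)
      + (36:ℤ) • ((L*L)*H0)
      + (2:ℤ) • (Radd)
  have H4 : 4*(P*L*L*L*L*L) + 4*(L*P*L*L*L*L) - 2*(L*L*P*L*L*L) - 3*(L*L*L*L*P*L) - 3*(L*L*L*L*L*P) - 32*(L*L*L*L*L*L*L) = 0 := by
    refine hk 24 3 (by norm_num) _ ?_
    linear_combination (norm := noncomm_ring)
      (1:ℤ) • (Race)
      + (12:ℤ) • (H0*(L*L))
      + (18:ℤ) • (H2*(L))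
      + (7:ℤ) • ((L)*H1)
      - (4:ℤ) • ((L)*H0*(L))
      + (6:ℤ) • ((L)*H2)
      + (20:ℤ) • ((L*L)*H0)
      - (2:ℤ) • (Radd)
  have H5 : 1*(L*L*L*P*P) + 2*(L*L*L*P*L*L) + 1*(L*L*L*L*P*L) + 5*(L*L*L*L*L*P) + 20*(L*L*L*L*L*L*L) = 0 := by
    refine hk 12 2 (by norm_num) _ ?_
    linear_combination (norm := noncomm_ring)
      (1:ℤ) • (Radd)
      - (1:ℤ) • ((L)*H1)
      - (2:ℤ) • ((L)*H0*(L))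
      - (6:ℤ) • ((L)*H2)
      + (4:ℤ) • ((L*L)*H0)
  have H6 : 2*(P*L*L*P*P) + 8*(P*L*L*L*L*P) + 4*(L*P*L*L*P*L) + 4*(L*P*L*L*L*P) - 4*(L*L*P*L*L*L*L) + 5*(L*L*L*L*P*L*L) - 26*(L*L*L*L*L*P*L) - 31*(L*L*L*L*L*L*P) - 64*(L*L*L*L*L*L*L*L) = 0 := by
    refine hk 1 0 (by norm_num) _ ?_
    linear_combination (norm := noncomm_ring)
      - (2:ℤ) • (H3*(L))
      + (2:ℤ) • ((P*L)*H0)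
      + (8:ℤ) • (H2*(L*L))
      - (8:ℤ) • ((L)*H2*(L))
      - (12:ℤ) • ((L*L)*H0*(L))
      + (7:ℤ) • ((L*L*L)*H0)
      + (2:ℤ) • (H1*(P))
      - (2:ℤ) • ((P)*H1)
      - (2:ℤ) • (H0*(L*P))
      - (8:ℤ) • (H0*(L*L*L))
      - (2:ℤ) • (H2*(P))
      + (2:ℤ) • ((L)*H0*(P))
      + (20:ℤ) • ((L)*H0*(L*L))
      - (8:ℤ) • ((L)*H3)
      - (6:ℤ) • (H0*(P*L))
      + (6:ℤ) • ((P)*H2)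
      + (6:ℤ) • ((L*P)*H0)
      + (6:ℤ) • ((L)*H4)
      + (12:ℤ) • ((L*L)*H2)
      + (9:ℤ) • (H5*(L))
      + (9:ℤ) • ((L)*H5)
  have H7 : 2*(P*L*L*P*L*L) - 1*(P*L*L*L*P*L) - 1*(P*L*L*L*L*P) - 3*(L*P*L*L*P*L) - 1*(L*P*L*L*L*P) + 2*(L*L*P*L*L*P) + 20*(L*L*P*L*L*L*L) + 4*(L*L*L*L*L*P*L) - 8*(L*L*L*L*L*L*P) - 72*(L*L*L*L*L*L*L*L) = 0 := by
    refine hk 2 1 (by norm_num) _ ?_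
    linear_combination (norm := noncomm_ring)
      - (1:ℤ) • (H0*(L*P))
      - (4:ℤ) • (H0*(L*L*L))
      - (1:ℤ) • (H2*(P))
      + (2:ℤ) • (H2*(L*L))
      - (2:ℤ) • (H4*(L))
      + (1:ℤ) • ((L)*H0*(P))
      + (6:ℤ) • ((L)*H0*(L*L))
      - (2:ℤ) • ((L)*H2*(L))
      + (8:ℤ) • ((L)*H4)
      - (2:ℤ) • ((L*L)*H1)
      - (4:ℤ) • ((L*L)*H0*(L))
      + (6:ℤ) • ((L*L)*H2)
      - (2:ℤ) • (H3*(L))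
      + (2:ℤ) • ((P*L)*H0)
      - (1:ℤ) • (H0*(P*L))
      + (1:ℤ) • ((P)*H2)
      + (1:ℤ) • ((L*P)*H0)
      - (4:ℤ) • ((L*L*L)*H0)
      + (8:ℤ) • (H5*(L))
  have H8 : 2*(L*L*L*P*L*P) + 1*(L*L*L*L*P*L*L) + 4*(L*L*L*L*L*P*L) + 11*(L*L*L*L*L*L*P) + 40*(L*L*L*L*L*L*L*L) = 0 := by
    refine hk 2 1 (by norm_num) _ ?_
    linear_combination (norm := noncomm_ring)
      (4:ℤ) • (H0*(P*L))
      - (4:ℤ) • ((P)*H2)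
      + (2:ℤ) • (H0*(L*P))
      + (8:ℤ) • (H0*(L*L*L))
      + (2:ℤ) • (H2*(P))
      - (4:ℤ) • (H2*(L*L))
      - (2:ℤ) • (H4*(L))
      - (4:ℤ) • ((L*P)*H0)
      - (2:ℤ) • ((L)*H0*(P))
      - (16:ℤ) • ((L)*H0*(L*L))
      + (4:ℤ) • ((L)*H2*(L))
      - (4:ℤ) • ((L)*H4)
      + (2:ℤ) • ((L*L)*H1)
      + (12:ℤ) • ((L*L)*H0*(L))
      - (8:ℤ) • ((L*L)*H2)
      - (2:ℤ) • ((L*L*L)*H0)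
      + (2:ℤ) • ((L)*H5)
      + (2:ℤ) • (H3*(L))
      - (2:ℤ) • ((P*L)*H0)
      - (1:ℤ) • (H1*(P))
      + (1:ℤ) • ((P)*H1)
      + (4:ℤ) • ((L)*H3)
      - (14:ℤ) • (H5*(L))
  have H9 : 4*(L*L*L*P*L*L*L) + 3*(L*L*L*L*P*L*L) + 6*(L*L*L*L*L*P*L) + 3*(L*L*L*L*L*L*P) + 32*(L*L*L*L*L*L*L*L) = 0 := by
    refine hk 1 0 (by norm_num) _ ?_
    linear_combination (norm := noncomm_ring)
      (1:ℤ) • (H5*(L))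
      - (1:ℤ) • ((L*L*L)*H0)
      + (1:ℤ) • ((L)*H5)
  have H10 : 36*(P*L*L*P*L*P) + 48*(L*P*L*L*L*P*L) + 48*(L*P*L*L*L*L*P) + 48*(L*L*P*L*L*P*L) + 264*(L*L*P*L*L*L*P) + 3129*(L*L*L*L*L*L*P*L) + 447*(L*L*L*L*L*L*L*P) + 3472*(L*L*L*L*L*L*L*L*L) = 0 := by
    refine hk 2 1 (by norm_num) _ ?_
    linear_combination (norm := noncomm_ring)
      - (36:ℤ) • (H3*(P))
      + (36:ℤ) • ((P*L)*H1)
      - (216:ℤ) • (H2*(L*P))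
      + (56:ℤ) • (H2*(L*L*L))
      + (10:ℤ) • ((P)*H5)
      + (108:ℤ) • (H4*(P))
      - (818:ℤ) • (H4*(L*L))
      + (216:ℤ) • ((L)*H2*(P))
      + (232:ℤ) • ((L)*H2*(L*L))
      - (384:ℤ) • ((L)*H7)
      - (190:ℤ) • ((L)*H4*(L))
      - (216:ℤ) • ((L*L)*H0*(P))
      + (688:ℤ) • ((L*L)*H0*(L*L))
      - (232:ℤ) • ((L*L)*H2*(L))
      + (1830:ℤ) • ((L*L)*H4)
      + (432:ℤ) • ((L*L*L)*H1)
      - (456:ℤ) • ((L*L*L)*H0*(L))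
      + (336:ℤ) • ((L*L*L)*H2)
      - (1805:ℤ) • (H9*(L))
      - (352:ℤ) • ((L*L*L*L)*H0)
      - (816:ℤ) • ((L)*H8)
      + (944:ℤ) • ((L)*H9)
      + (3136:ℤ) • ((L*L)*H5)
      - (67:ℤ) • (H6*(L))
      + (278:ℤ) • ((P*L*L)*H0)
      - (268:ℤ) • (H7*(L))
      - (144:ℤ) • (H2*(P*L))
      + (144:ℤ) • ((P*L)*H2)
      + (144:ℤ) • ((L*P*L)*H0)
      - (144:ℤ) • ((L)*H6)
      - (144:ℤ) • ((L*L*P)*H0)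
      - (52:ℤ) • (H8*(L))
      + (920:ℤ) • (H0*(L*L*L*L))
      - (230:ℤ) • ((P)*H4)
      - (920:ℤ) • ((L)*H0*(L*L*L))
  have H11 : 48*(P*L*L*L*P*L*L) - 72*(L*P*L*L*L*P*L) - 72*(L*P*L*L*L*L*P) - 72*(L*L*P*L*L*P*L) - 48*(L*L*P*L*L*L*P) - 159*(L*L*L*L*L*L*P*L) - 9*(L*L*L*L*L*L*L*P) + 1072*(L*L*L*L*L*L*L*L*L) = 0 := by
    refine hk 2 1 (by norm_num) _ ?_
    linear_combination (norm := noncomm_ring)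
      - (73:ℤ) • (H6*(L))
      + (50:ℤ) • ((P*L*L)*H0)
      - (196:ℤ) • (H7*(L))
      - (146:ℤ) • ((P)*H5)
      - (72:ℤ) • (H4*(P))
      - (830:ℤ) • (H4*(L*L))
      + (240:ℤ) • ((L)*H7)
      + (1406:ℤ) • ((L)*H4*(L))
      - (714:ℤ) • ((L*L)*H4)
      - (767:ℤ) • (H9*(L))
      + (420:ℤ) • ((L)*H8)
      + (2804:ℤ) • ((L)*H9)
      - (4376:ℤ) • ((L*L)*H5)
      + (96:ℤ) • (H2*(P*L))
      - (96:ℤ) • ((P*L)*H2)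
      + (96:ℤ) • (H2*(L*P))
      + (584:ℤ) • (H2*(L*L*L))
      - (96:ℤ) • ((L*P*L)*H0)
      - (96:ℤ) • ((L)*H2*(P))
      - (776:ℤ) • ((L)*H2*(L*L))
      + (96:ℤ) • ((L)*H6)
      + (96:ℤ) • ((L*L*P)*H0)
      + (96:ℤ) • ((L*L)*H0*(P))
      + (976:ℤ) • ((L*L)*H0*(L*L))
      + (776:ℤ) • ((L*L)*H2*(L))
      - (192:ℤ) • ((L*L*L)*H1)
      - (1752:ℤ) • ((L*L*L)*H0*(L))
      - (288:ℤ) • ((L*L*L)*H2)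
      + (2912:ℤ) • ((L*L*L*L)*H0)
      - (244:ℤ) • (H8*(L))
      + (200:ℤ) • (H0*(L*L*L*L))
      - (50:ℤ) • ((P)*H4)
      - (200:ℤ) • ((L)*H0*(L*L*L))
  have H12 : 144*(P*L*L*L*L*P*L) + 240*(L*P*L*L*L*P*L) + 96*(L*P*L*L*L*L*P) + 240*(L*L*P*L*L*P*L) + 168*(L*L*P*L*L*L*P) - 3813*(L*L*L*L*L*L*P*L) - 1491*(L*L*L*L*L*L*L*P) - 7408*(L*L*L*L*L*L*L*L*L) = 0 := by
    refine hk 2 1 (by norm_num) _ ?_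
    linear_combination (norm := noncomm_ring)
      - (144:ℤ) • (H2*(P*L))
      + (144:ℤ) • ((P*L)*H2)
      - (144:ℤ) • (H2*(L*P))
      - (1448:ℤ) • (H2*(L*L*L))
      - (266:ℤ) • ((P*L*L)*H0)
      + (532:ℤ) • (H7*(L))
      + (72:ℤ) • (H4*(P))
      + (2102:ℤ) • (H4*(L*L))
      + (144:ℤ) • ((L*P*L)*H0)
      + (144:ℤ) • ((L)*H2*(P))
      + (1736:ℤ) • ((L)*H2*(L*L))
      - (144:ℤ) • ((L)*H6)
      - (2966:ℤ) • ((L)*H4*(L))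
      - (144:ℤ) • ((L*L*P)*H0)
      - (144:ℤ) • ((L*L)*H0*(P))
      - (2608:ℤ) • ((L*L)*H0*(L*L))
      - (1736:ℤ) • ((L*L)*H2*(L))
      + (690:ℤ) • ((L*L)*H4)
      + (288:ℤ) • ((L*L*L)*H1)
      + (4344:ℤ) • ((L*L*L)*H0*(L))
      + (672:ℤ) • ((L*L*L)*H2)
      + (3179:ℤ) • (H9*(L))
      - (6656:ℤ) • ((L*L*L*L)*H0)
      - (804:ℤ) • ((L)*H8)
      - (7844:ℤ) • ((L)*H9)
      + (8984:ℤ) • ((L*L)*H5)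
      + (205:ℤ) • (H6*(L))
      + (410:ℤ) • ((P)*H5)
      - (480:ℤ) • ((L)*H7)
      + (532:ℤ) • (H8*(L))
      - (872:ℤ) • (H0*(L*L*L*L))
      + (218:ℤ) • ((P)*H4)
      + (872:ℤ) • ((L)*H0*(L*L*L))
  have H13 : 48*(L*L*L*P*L*L*P) - 1587*(L*L*L*L*L*L*P*L) - 693*(L*L*L*L*L*L*L*P) - 4016*(L*L*L*L*L*L*L*L*L) = 0 := by
    refine hk 2 1 (by norm_num) _ ?_
    linear_combination (norm := noncomm_ring)
      (188:ℤ) • (H8*(L))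
      + (96:ℤ) • ((L*L*L)*H2)
      + (1261:ℤ) • (H9*(L))
      - (48:ℤ) • ((L)*H8)
      - (2560:ℤ) • ((L)*H9)
      + (1984:ℤ) • ((L*L)*H5)
      - (472:ℤ) • (H0*(L*L*L*L))
      + (118:ℤ) • ((P)*H4)
      - (472:ℤ) • (H2*(L*L*L))
      + (236:ℤ) • (H7*(L))
      + (826:ℤ) • (H4*(L*L))
      + (472:ℤ) • ((L)*H0*(L*L*L))
      + (472:ℤ) • ((L)*H2*(L*L))
      - (826:ℤ) • ((L)*H4*(L))
      - (944:ℤ) • ((L*L)*H0*(L*L))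
      - (472:ℤ) • ((L*L)*H2*(L))
      - (354:ℤ) • ((L*L)*H4)
      + (1416:ℤ) • ((L*L*L)*H0*(L))
      - (1888:ℤ) • ((L*L*L*L)*H0)
      + (59:ℤ) • (H6*(L))
      - (118:ℤ) • ((P*L*L)*H0)
      + (118:ℤ) • ((P)*H5)
  have H14 : 6*(L*L*L*L*L*P*L*L) - 21*(L*L*L*L*L*L*P*L) - 9*(L*L*L*L*L*L*L*P) - 16*(L*L*L*L*L*L*L*L*L) = 0 := by
    refine hk 2 1 (by norm_num) _ ?_
    linear_combination (norm := noncomm_ring)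
      - (8:ℤ) • (H0*(L*L*L*L))
      + (2:ℤ) • ((P)*H4)
      - (8:ℤ) • (H2*(L*L*L))
      + (4:ℤ) • (H7*(L))
      + (14:ℤ) • (H4*(L*L))
      + (8:ℤ) • ((L)*H0*(L*L*L))
      + (8:ℤ) • ((L)*H2*(L*L))
      - (14:ℤ) • ((L)*H4*(L))
      - (16:ℤ) • ((L*L)*H0*(L*L))
      - (8:ℤ) • ((L*L)*H2*(L))
      - (6:ℤ) • ((L*L)*H4)
      + (24:ℤ) • ((L*L*L)*H0*(L))
      + (23:ℤ) • (H9*(L))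
      - (32:ℤ) • ((L*L*L*L)*H0)
      - (44:ℤ) • ((L)*H9)
      + (32:ℤ) • ((L*L)*H5)
      + (1:ℤ) • (H6*(L))
      - (2:ℤ) • ((P*L*L)*H0)
      + (2:ℤ) • ((P)*H5)
      + (4:ℤ) • (H8*(L))
  have V9 : 10635*(L*L*L*L*L*L*L*P*L) + 3453*(L*L*L*L*L*L*L*L*P) + 7600*(L*L*L*L*L*L*L*L*L*L) = 0 := by
    refine hk 1 0 (by norm_num) _ ?_
    linear_combination (norm := noncomm_ring)
      (24:ℤ) • (H8*(P))
      - (48:ℤ) • ((L*L*L)*H3)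
      - (2:ℤ) • (H13*(L))
      + (24:ℤ) • (H9*(P))
      + (96:ℤ) • ((L)*H9*(L))
      - (72:ℤ) • ((L*L)*H8)
      - (48:ℤ) • ((L*L)*H9)
      - (336:ℤ) • ((L*L*L)*H5)
      - (477:ℤ) • ((L)*H14)
  have V10 : - 531*(L*L*L*L*L*L*L*P*L) - 213*(L*L*L*L*L*L*L*L*P) - 112*(L*L*L*L*L*L*L*L*L*L) = 0 := by
    refine hk 1 0 (by norm_num) _ ?_
    linear_combination (norm := noncomm_ring)
      (32:ℤ) • (H9*(L*L))
      - (32:ℤ) • ((L*L*L)*H4)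
      + (8:ℤ) • ((L)*H9*(L))
      - (70:ℤ) • ((L*L)*H9)
      + (11:ℤ) • ((L)*H14)
  have V13 : - 143*(L*L*L*L*L*L*L*P*L) - 57*(L*L*L*L*L*L*L*L*P) - 176*(L*L*L*L*L*L*L*L*L*L) = 0 := by
    refine hk 3 1 (by norm_num) _ ?_
    linear_combination (norm := noncomm_ring)
      (4:ℤ) • (H14*(L))
      - (6:ℤ) • ((L*L)*H9)
      + (17:ℤ) • ((L)*H14)
  have V5 : 1392*(L*L*P*L*L*L*P*L) + 2256*(L*L*P*L*L*L*L*P) + 110733*(L*L*L*L*L*L*L*P*L) + 43083*(L*L*L*L*L*L*L*L*P) + 185872*(L*L*L*L*L*L*L*L*L*L) = 0 := by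
    refine hk 1 0 (by norm_num) _ ?_
    linear_combination (norm := noncomm_ring)
      (2304:ℤ) • (H2*(L*L*L*L))
      - (576:ℤ) • ((P*L)*H4)
      - (288:ℤ) • ((P)*H9)
      + (6:ℤ) • (H12*(L))
      - (216:ℤ) • (H4*(L*P))
      - (4608:ℤ) • (H4*(L*L*L))
      - (2304:ℤ) • ((L)*H2*(L*L*L))
      + (1152:ℤ) • ((L)*H7*(L))
      - (6:ℤ) • ((L)*H11)
      + (4:ℤ) • ((L)*H12)
      + (216:ℤ) • ((L)*H4*(P))
      + (5760:ℤ) • ((L)*H4*(L*L))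
      + (2304:ℤ) • ((L*L)*H0*(L*L*L))
      + (2304:ℤ) • ((L*L)*H2*(L*L))
      - (144:ℤ) • ((L*L)*H7)
      - (6912:ℤ) • ((L*L)*H4*(L))
      - (4608:ℤ) • ((L*L*L)*H0*(L*L))
      - (2304:ℤ) • ((L*L*L)*H2*(L))
      - (38:ℤ) • (H13*(L))
      - (168:ℤ) • (H9*(P))
      + (1728:ℤ) • ((L*L*L)*H4)
      + (6912:ℤ) • ((L*L*L*L)*H0*(L))
      + (2304:ℤ) • ((L*L*L*L)*H2)
      - (45:ℤ) • ((L)*H13)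
      - (2160:ℤ) • ((L)*H9*(L))
      - (9216:ℤ) • ((L*L*L*L*L)*H0)
      - (648:ℤ) • ((L*L)*H8)
      - (7020:ℤ) • ((L*L)*H9)
      + (12672:ℤ) • ((L*L*L)*H5)
      - (2188:ℤ) • ((L)*H14)
  have V8 : 24504*(L*L*P*L*L*L*P*L) + 26664*(L*L*P*L*L*L*L*P) + 2347539*(L*L*L*L*L*L*L*P*L) + 1002069*(L*L*L*L*L*L*L*L*P) + 3408880*(L*L*L*L*L*L*L*L*L*L) = 0 := by
    refine hk 1 0 (by norm_num) _ ?_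
    linear_combination (norm := noncomm_ring)
      (432:ℤ) • (H6*(P))
      - (864:ℤ) • ((P*L*L)*H1)
      + (864:ℤ) • (H7*(P))
      + (3456:ℤ) • (H7*(L*L))
      + (1296:ℤ) • ((P)*H8)
      + (2592:ℤ) • ((P)*H9)
      - (4320:ℤ) • ((P*L)*H5)
      + (21:ℤ) • (H12*(L))
      - (3240:ℤ) • (H4*(P*L))
      - (1836:ℤ) • (H4*(L*P))
      - (20736:ℤ) • (H4*(L*L*L))
      + (24:ℤ) • ((L)*H10)
      + (5184:ℤ) • ((L)*H7*(L))
      - (864:ℤ) • ((L*P)*H5)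
      + (111:ℤ) • ((L)*H11)
      + (118:ℤ) • ((L)*H12)
      + (2916:ℤ) • ((L)*H4*(P))
      + (25056:ℤ) • ((L)*H4*(L*L))
      - (864:ℤ) • ((L*L)*H6)
      + (1800:ℤ) • ((L*L)*H7)
      - (52704:ℤ) • ((L*L)*H4*(L))
      - (479:ℤ) • (H13*(L))
      - (2436:ℤ) • (H9*(P))
      + (39312:ℤ) • ((L*L*L)*H4)
      - (9720:ℤ) • ((L*L*L*L)*H2)
      + (120:ℤ) • ((L)*H13)
      - (81360:ℤ) • ((L)*H9*(L))
      - (9720:ℤ) • ((L*L*L*L*L)*H0)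
      + (17676:ℤ) • ((L*L)*H8)
      + (80460:ℤ) • ((L*L)*H9)
      + (36360:ℤ) • ((L*L*L)*H5)
      - (102478:ℤ) • ((L)*H14)
  have V12 : - 636*(L*L*P*L*L*L*P*L) - 564*(L*L*P*L*L*L*L*P) - 73653*(L*L*L*L*L*L*L*P*L) - 29475*(L*L*L*L*L*L*L*L*P) - 79696*(L*L*L*L*L*L*L*L*L*L) = 0 := by
    refine hk 2 1 (by norm_num) _ ?_
    linear_combination (norm := noncomm_ring)
      (12:ℤ) • (H11*(L))
      - (144:ℤ) • ((P)*H9)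
      + (3:ℤ) • (H12*(L))
      + (216:ℤ) • (H4*(P*L))
      + (108:ℤ) • (H4*(L*P))
      + (1152:ℤ) • (H4*(L*L*L))
      + (3:ℤ) • ((L)*H11)
      - (2:ℤ) • ((L)*H12)
      - (108:ℤ) • ((L)*H4*(P))
      - (1152:ℤ) • ((L)*H4*(L*L))
      + (72:ℤ) • ((L*L)*H7)
      + (1728:ℤ) • ((L*L)*H4*(L))
      + (19:ℤ) • (H13*(L))
      + (84:ℤ) • (H9*(P))
      - (2304:ℤ) • ((L*L*L)*H4)
      + (648:ℤ) • ((L*L*L*L)*H2)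
      - (15:ℤ) • ((L)*H13)
      + (3024:ℤ) • ((L)*H9*(L))
      + (648:ℤ) • ((L*L*L*L*L)*H0)
      - (576:ℤ) • ((L*L)*H8)
      - (3420:ℤ) • ((L*L)*H9)
      - (576:ℤ) • ((L*L*L)*H5)
      + (6728:ℤ) • ((L)*H14)
  refine hk 9216 10 (by norm_num) _ ?_
  linear_combination (norm := noncomm_ring)
    - (110474:ℤ) • V9 + (254236:ℤ) • V10 - (6973242:ℤ) • V13 + (6129:ℤ) • V5 - (1269:ℤ) • V8 - (35478:ℤ) • V12

/-- Full polarization of `x⁴ = 0` in a commutative algebra (divided by two). -/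
theorem polar4 {A : Type*} [NonUnitalNonAssocRing A]
    (hcomm : ∀ a b : A, a * b = b * a)
    (hc2 : ∀ x : A, (2 : ℤ) • x = 0 → x = 0)
    (hx4 : ∀ x : A, x * (x * (x * x)) = 0) (x y z w : A) :
    x * (y * (z * w)) + x * (z * (y * w)) + y * (x * (z * w)) + y * (z * (x * w))
    + z * (x * (y * w)) + z * (y * (x * w)) + x * (w * (y * z)) + y * (w * (x * z))
    + z * (w * (x * y)) + w * (x * (y * z)) + w * (y * (x * z)) + w * (z * (x * y)) = 0 := by
  apply hc2
  have e1 := hx4 (x + y + z + w)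
  have e2 := hx4 (x + y + z)
  have e3 := hx4 (x + y + w)
  have e4 := hx4 (x + z + w)
  have e5 := hx4 (y + z + w)
  have e6 := hx4 (x + y)
  have e7 := hx4 (x + z)
  have e8 := hx4 (x + w)
  have e9 := hx4 (y + z)
  have e10 := hx4 (y + w)
  have e11 := hx4 (z + w)
  have e12 := hx4 x
  have e13 := hx4 y
  have e14 := hx4 z
  have e15 := hx4 w
  simp only [mul_add, add_mul] at e1 e2 e3 e4 e5 e6 e7 e8 e9 e10 e11
  simp only [hcomm y x, hcomm z x, hcomm w x, hcomm z y, hcomm w y, hcomm w z] at *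
  linear_combination (norm := abel) e1 - e2 - e3 - e4 - e5 + e6 + e7 + e8 + e9 + e10 + e11
    - e12 - e13 - e14 - e15

theorem core_alg {A : Type*} [NonUnitalNonAssocRing A]
    (hcomm : ∀ a b : A, a * b = b * a)
    (hk : ∀ (K m : ℕ), K ∣ 6 ^ m → ∀ x : A, (K : ℤ) • x = 0 → x = 0)
    (hx4 : ∀ x : A, x * (x * (x * x)) = 0) (a : A) :
    ∀ b : A, a * (a * (a * (a * (a * (a * (a * (a * (a * (a * b))))))))) = 0 := by
  have pol := polar4 hcomm (fun x hx => hk 2 1 (by norm_num) x (by exact_mod_cast hx)) hx4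
  obtain ⟨c, hc⟩ : ∃ c, a * a = c := ⟨_, rfl⟩
  obtain ⟨d, hd⟩ : ∃ d, a * c = d := ⟨_, rfl⟩
  obtain ⟨e, he⟩ : ∃ e, c * c = e := ⟨_, rfl⟩
  obtain ⟨f, hf⟩ : ∃ f, a * e = f := ⟨_, rfl⟩
  obtain ⟨g, hg⟩ : ∃ g, a * f = g := ⟨_, rfl⟩
  have hca : c * a = d := by rw [hcomm, hd]
  have hea : e * a = f := by rw [hcomm, hf]
  have hfa : f * a = g := by rw [hcomm, hg]
  have had : a * d = 0 := by rw [← hd, ← hc]; exact hx4 a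
  have hda : d * a = 0 := by rw [hcomm, had]
  -- degree five
  have hcd : c * d = - f := by
    have h := pol a a a c
    simp only [hc, hd, he, hf, hg, hca, hea, hfa, had, hda, mul_zero] at h
    apply eq_neg_of_add_eq_zero_left
    refine hk 3 1 (by norm_num) _ ?_
    linear_combination (norm := (push_cast; module)) h
  have hdc : d * c = - f := by rw [hcomm, hcd]
  -- degree six
  have hdd : d * d = g := by
    have h := pol a a a d
    simp only [hc, hd, he, hf, hg, hca, hea, hfa, had, hda, hcd, hdc, mul_zero, mul_neg] at h
    apply eq_of_sub_eq_zero
    refine hk 3 1 (by norm_num) _ ?_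
    linear_combination (norm := (push_cast; module)) h
  have hce : c * e = g := by
    have h := pol a a c c
    simp only [hc, hd, he, hf, hg, hca, hea, hfa, had, hda, hcd, hdc, mul_zero, mul_neg] at h
    apply eq_of_sub_eq_zero
    refine hk 2 1 (by norm_num) _ ?_
    linear_combination (norm := (push_cast; module)) h
  have hec : e * c = g := by rw [hcomm, hce]
  -- degree seven
  have h71 := pol a a a e
  have h72 := pol a a c d
  have h73 := pol a c c c
  simp only [hc, hd, he, hf, hg, hca, hea, hfa, had, hda, hcd, hdc, hdd, hce, hec, hcomm e d,
    hcomm f c, mul_zero, mul_neg] at h71 h72 h73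
  have hag : a * g = 0 := by
    refine hk 12 2 (by norm_num) _ ?_
    linear_combination (norm := (push_cast; module)) h71 - (3 : ℤ) • h72 + h73
  have hcf : c * f = 0 := by
    rw [hag] at h73
    refine hk 3 1 (by norm_num) _ ?_
    linear_combination (norm := (push_cast; module)) - h73
  have hde : d * e = 0 := by
    rw [hag] at h71
    refine hk 3 1 (by norm_num) _ ?_
    linear_combination (norm := (push_cast; module)) h71
  have hed : e * d = 0 := by rw [hcomm, hde]
  -- operators
  obtain ⟨M, hM⟩ : ∃ M : A →+ Module.End ℤ A, ∀ x y, M x y = x * y :=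
    ⟨(LinearMap.mul ℤ A).toAddMonoidHom, fun x y => rfl⟩
  have hkE : ∀ (K m : ℕ), K ∣ 6 ^ m → ∀ x : Module.End ℤ A, (K : ℤ) • x = 0 → x = 0 := by
    intro K m hK x hx
    ext y
    refine hk K m hK _ ?_
    have := LinearMap.congr_fun hx y
    simpa using this
  have RE : ∀ u v w : A,
      M u * M v * M w + M u * M w * M v + M v * M u * M w + M v * M w * M u
      + M w * M u * M v + M w * M v * M u + M u * M (v * w) + M v * M (u * w) + M w * M (u * v)
      + M (u * (v * w)) + M (v * (u * w)) + M (w * (u * v)) = 0 := by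
    intro u v w
    ext m
    have h := pol u v w m
    rw [hcomm m (v * w), hcomm m (u * w), hcomm m (u * v), hcomm m (u * (v * w)),
      hcomm m (v * (u * w)), hcomm m (w * (u * v))] at h
    simpa [hM] using h
  have raaa := RE a a a
  have raac := RE a a c
  have racc := RE a c c
  have raae := RE a a e
  have raad := RE a a d
  have racd := RE a c d
  have rccc := RE c c c
  have race := RE a c e
  have radd := RE a d d
  simp only [hc, hd, he, hf, hg, hca, hea, hfa, had, hda, hcd, hdc, hdd, hce, hec, hag, hcf, hde,
    hed, mul_zero, mul_neg, map_neg, map_zero] at raaa raac racc raae raad racd rccc race radd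
  have hfin : M a * M a * M a * M a * M a * M a * M a * M a * M a * M a = 0 := by
    generalize M a = L at *
    generalize M c = P at *
    generalize M d = D at *
    generalize M e = E at *
    generalize M f = F at *
    generalize M g = G at *
    obtain rfl : D = - 2 * (L * L * L) - L * P := by
      apply eq_of_sub_eq_zero
      refine hkE 3 1 (by norm_num) _ ?_
      linear_combination (norm := noncomm_ring) raaa
    obtain rfl : E = 4 * (L * L * L * L) - 2 * (L * P * L) - 2 * (P * L * L) - P * P := by
      linear_combination (norm := noncomm_ring) raac
    obtain rfl : F = L * P * P + 4 * (L * L * L * L * L) - 2 * (L * L * P * L) - 2 * (L * P * L * L)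
        - 4 * (P * L * L * L) + 2 * (P * P * L) := by
      linear_combination (norm := noncomm_ring) - racc
    apply core_ring L P hkE
    · refine hkE 2 1 (by norm_num) _ ?_
      linear_combination (norm := noncomm_ring) raad
    · refine hkE 1 1 (by norm_num) _ ?_
      linear_combination (norm := noncomm_ring) racd
    · refine hkE 2 1 (by norm_num) _ ?_
      linear_combination (norm := noncomm_ring) rccc - raae
    · refine hkE 1 1 (by norm_num) _ ?_
      linear_combination (norm := noncomm_ring) (3 : ℤ) • race - L * raae
    · refine hkE 1 1 (by norm_num) _ ?_
      linear_combination (norm := noncomm_ring) (3 : ℤ) • radd - L * raae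
  intro b
  have := LinearMap.congr_fun hfin b
  simpa [hM] using this

theorem stmt_12 {F A : Type*} [Field F] [NonUnitalNonAssocRing A]
    [Module F A] [SMulCommClass F A A] [IsScalarTower F A A]
    (hcomm : ∀ a b : A, a * b = b * a)
    (h2 : (2 : F) ≠ 0) (h3 : (3 : F) ≠ 0)
    (hx4 : ∀ x : A, x * (x * (x * x)) = 0)
    (a b : A) :
    a * (a * (a * (a * (a * (a * (a * (a * (a * (a * (b)))))))))) = 0 := by
  refine core_alg hcomm ?_ hx4 a b
  intro K m hK x hx
  have h6 : (6 : F) ≠ 0 := by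
    have : (6 : F) = 2 * 3 := by norm_num
    rw [this]
    exact mul_ne_zero h2 h3
  have hKF : (K : F) ≠ 0 := by
    intro h0
    obtain ⟨q, hq⟩ := hK
    have h := congrArg (Nat.cast : ℕ → F) hq
    push_cast at h
    rw [h0, zero_mul] at h
    exact pow_ne_zero m h6 h
  have hx' : (K : F) • x = 0 := by
    rw [Nat.cast_smul_eq_nsmul]
    rwa [natCast_zsmul] at hx
  exact (smul_eq_zero.mp hx').resolve_left hKF
end

section
/- For every x ∈ 𝔄 the multiplication operator identity L⁸U = 0 holds; that is, x·(x·(x·(x·(x·(x·(x·(x·(x²·y)))))))) = 0 for all y ∈ 𝔄. -/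
set_option maxHeartbeats 4000000 in
theorem cert_LU {A : Type*} [AddCommGroup A] (L U : A →+ A)
    (r122 : ∀ y, (16:ℤ) • L (L (L (L (L y)))) + (-4:ℤ) • U (L (L (L y))) + (4:ℤ) • L (L (L (U y))) + (2:ℤ) • L (U (U y)) + (2:ℤ) • U (U (L y)) = 0)
    (r123 : ∀ y, (2:ℤ) • L (L (L (L (U y)))) + (16:ℤ) • L (L (L (L (L (L y))))) + (2:ℤ) • L (L (U (L (L y)))) + (-1:ℤ) • U (L (L (U y))) + (-4:ℤ) • U (L (L (L (L y)))) + (-1:ℤ) • U (L (U (L y))) + (-1:ℤ) • L (U (L (U y))) + (-1:ℤ) • L (U (U (L y))) = 0)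
    (r114 : ∀ y, (-16:ℤ) • U (L (L (L (L y)))) + (6:ℤ) • U (L (U (L y))) + (4:ℤ) • U (U (L (L y))) + (-4:ℤ) • U (U (U y)) + (-4:ℤ) • L (L (U (U y))) + (-4:ℤ) • L (L (L (L (U y)))) + (-8:ℤ) • L (L (L (U (L y)))) + (-12:ℤ) • L (L (U (L (L y)))) + (-2:ℤ) • L (U (L (U y))) + (-2:ℤ) • U (L (L (U y))) + (-2:ℤ) • L (U (U (L y))) + (-8:ℤ) • L (U (L (L (L y)))) = 0)
    (r133 : ∀ y, (4:ℤ) • L (U (L (U (L y)))) + (2:ℤ) • L (U (U (L (L y)))) + (-1:ℤ) • L (U (U (U y))) + (2:ℤ) • L (L (U (L (U y)))) + (4:ℤ) • L (L (U (L (L (L y))))) + (8:ℤ) • L (L (L (L (L (U y))))) + (24:ℤ) • L (L (L (L (L (L (L y)))))) + (2:ℤ) • L (U (L (L (U y)))) + (4:ℤ) • L (L (L (L (U (L y))))) + (4:ℤ) • L (U (L (L (L (L y))))) = 0)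
    (r124 : ∀ y, (-3:ℤ) • L (U (U (U y))) + (-2:ℤ) • U (L (U (U y))) + (-4:ℤ) • U (L (L (L (U y)))) + (-6:ℤ) • U (L (L (U (L y)))) + (-6:ℤ) • U (L (U (L (L y)))) + (-8:ℤ) • L (L (L (L (L (L (L y)))))) + (4:ℤ) • L (U (L (L (L (L y))))) + (-2:ℤ) • L (L (U (L (U y)))) + (-2:ℤ) • U (U (U (L y))) + (4:ℤ) • L (L (L (L (L (U y))))) + (-2:ℤ) • L (U (L (L (U y)))) + (4:ℤ) • L (L (L (L (U (L y))))) + (-2:ℤ) • L (U (L (U (L y)))) = 0)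
    (y : A) : (1536:ℤ) • L (L (L (L (L (L (L (L (U y)))))))) = 0 := by
  have h0 := r114 (L (L (L (L y))))
  have h1 := r114 (L (L (U y)))
  have h2 := r114 (L (U (L y)))
  have h3 := r114 (U (L (L y)))
  have h4 := r114 (U (U y))
  have h5 := congrArg (fun z => L z) (r114 (L (L (L y))))
  have h6 := congrArg (fun z => L z) (r114 (L (U y)))
  have h7 := congrArg (fun z => L (L z)) (r114 (L (L y)))
  have h8 := congrArg (fun z => L (L z)) (r114 (U y))
  have h9 := congrArg (fun z => L (L (L z))) (r114 (L y))
  have h10 := congrArg (fun z => L (L (L (L z)))) (r114 y)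
  have h11 := congrArg (fun z => L (U z)) (r114 (L y))
  have h12 := congrArg (fun z => L (U (L z))) (r114 y)
  have h13 := congrArg (fun z => U z) (r114 (L (L y)))
  have h14 := congrArg (fun z => U z) (r114 (U y))
  have h15 := congrArg (fun z => U (L z)) (r114 (L y))
  have h16 := congrArg (fun z => U (L (L z))) (r114 y)
  have h17 := r122 (L (L (L (L (L y)))))
  have h18 := r122 (L (L (L (U y))))
  have h19 := r122 (L (L (U (L y))))
  have h20 := r122 (L (U (L (L y))))
  have h21 := r122 (L (U (U y)))
  have h22 := r122 (U (L (L (L y))))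
  have h23 := r122 (U (L (U y)))
  have h24 := congrArg (fun z => L z) (r122 (L (L (L (L y)))))
  have h25 := congrArg (fun z => L z) (r122 (L (L (U y))))
  have h26 := congrArg (fun z => L z) (r122 (L (U (L y))))
  have h27 := congrArg (fun z => L z) (r122 (U (L (L y))))
  have h28 := congrArg (fun z => L (L z)) (r122 (L (L (L y))))
  have h29 := congrArg (fun z => L (L z)) (r122 (L (U y)))
  have h30 := congrArg (fun z => L (L z)) (r122 (U (L y)))
  have h31 := congrArg (fun z => L (L (L z))) (r122 (L (L y)))
  have h32 := congrArg (fun z => L (L (L z))) (r122 (U y))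
  have h33 := congrArg (fun z => L (L (L (L z)))) (r122 (L y))
  have h34 := congrArg (fun z => L (L (L (L (L z))))) (r122 y)
  have h35 := congrArg (fun z => L (L (L (U z)))) (r122 y)
  have h36 := congrArg (fun z => L (L (U z))) (r122 (L y))
  have h37 := congrArg (fun z => L (L (U (L z)))) (r122 y)
  have h38 := congrArg (fun z => L (U z)) (r122 (L (L y)))
  have h39 := congrArg (fun z => L (U z)) (r122 (U y))
  have h40 := congrArg (fun z => L (U (L z))) (r122 (L y))
  have h41 := congrArg (fun z => L (U (L (L z)))) (r122 y)
  have h42 := congrArg (fun z => L (U (U z))) (r122 y)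
  have h43 := congrArg (fun z => U z) (r122 (L (L (L y))))
  have h44 := congrArg (fun z => U z) (r122 (L (U y)))
  have h45 := congrArg (fun z => U z) (r122 (U (L y)))
  have h46 := congrArg (fun z => U (L z)) (r122 (L (L y)))
  have h47 := congrArg (fun z => U (L z)) (r122 (U y))
  have h48 := congrArg (fun z => U (L (L z))) (r122 (L y))
  have h49 := congrArg (fun z => U (L (L (L z)))) (r122 y)
  have h50 := congrArg (fun z => U (L (U z))) (r122 y)
  have h51 := congrArg (fun z => U (U z)) (r122 (L y))
  have h52 := congrArg (fun z => U (U (L z))) (r122 y)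
  have h53 := r123 (L (L (L (L y))))
  have h54 := r123 (L (L (U y)))
  have h55 := r123 (L (U (L y)))
  have h56 := r123 (U (L (L y)))
  have h57 := r123 (U (U y))
  have h58 := congrArg (fun z => L z) (r123 (L (L (L y))))
  have h59 := congrArg (fun z => L z) (r123 (L (U y)))
  have h60 := congrArg (fun z => L z) (r123 (U (L y)))
  have h61 := congrArg (fun z => L (L z)) (r123 (L (L y)))
  have h62 := congrArg (fun z => L (L z)) (r123 (U y))
  have h63 := congrArg (fun z => L (L (L z))) (r123 (L y))
  have h64 := congrArg (fun z => L (L (L (L z)))) (r123 y)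
  have h65 := congrArg (fun z => L (U z)) (r123 (L y))
  have h66 := congrArg (fun z => L (U (L z))) (r123 y)
  have h67 := congrArg (fun z => U z) (r123 (L (L y)))
  have h68 := congrArg (fun z => U z) (r123 (U y))
  have h69 := congrArg (fun z => U (L z)) (r123 (L y))
  have h70 := congrArg (fun z => U (L (L z))) (r123 y)
  have h71 := r124 (L (L (L y)))
  have h72 := r124 (U (L y))
  have h73 := congrArg (fun z => L z) (r124 (L (L y)))
  have h74 := congrArg (fun z => L z) (r124 (U y))
  have h75 := congrArg (fun z => L (L z)) (r124 (L y))
  have h76 := congrArg (fun z => L (L (L z))) (r124 y)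
  have h77 := congrArg (fun z => L (U z)) (r124 y)
  have h78 := congrArg (fun z => U z) (r124 (L y))
  have h79 := congrArg (fun z => U (L z)) (r124 y)
  have h80 := r133 (L (L (L y)))
  have h81 := r133 (L (U y))
  have h82 := congrArg (fun z => L z) (r133 (L (L y)))
  have h83 := congrArg (fun z => L z) (r133 (U y))
  have h84 := congrArg (fun z => L (L z)) (r133 (L y))
  have h85 := congrArg (fun z => L (L (L z))) (r133 y)
  have h86 := congrArg (fun z => L (U z)) (r133 y)
  have h87 := congrArg (fun z => U z) (r133 (L y))
  have h88 := congrArg (fun z => U (L z)) (r133 y)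
  simp only [map_add, map_zsmul, map_zero] at h0 h1 h2 h3 h4 h5 h6 h7 h8 h9 h10 h11 h12 h13 h14 h15 h16 h17 h18 h19 h20 h21 h22 h23 h24 h25 h26 h27 h28 h29 h30 h31 h32 h33 h34 h35 h36 h37 h38 h39 h40 h41 h42 h43 h44 h45 h46 h47 h48 h49 h50 h51 h52 h53 h54 h55 h56 h57 h58 h59 h60 h61 h62 h63 h64 h65 h66 h67 h68 h69 h70 h71 h72 h73 h74 h75 h76 h77 h78 h79 h80 h81 h82 h83 h84 h85 h86 h87 h88
  linear_combination (norm := module) (-7492:ℤ) • h0 + (282:ℤ) • h1 + (-720:ℤ) • h2 + (1722:ℤ) • h3 + (501:ℤ) • h4 + (-5074:ℤ) • h5 + (786:ℤ) • h6 + (13452:ℤ) • h7 + (-987:ℤ) • h8 + (3875:ℤ) • h9 + (2341:ℤ) • h10 + (-2163:ℤ) • h11 + (1680:ℤ) • h12 + (-900:ℤ) • h13 + (-501:ℤ) • h14 + (-5199:ℤ) • h15 + (-440:ℤ) • h16 + (-11912:ℤ) • h17 + (2268:ℤ) • h18 + (72:ℤ) • h19 + (564:ℤ) • h20 + (246:ℤ)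 • h21 + (4320:ℤ) • h22 + (1608:ℤ) • h23 + (12396:ℤ) • h24 + (-2124:ℤ) • h25 + (-4872:ℤ) • h26 + (7608:ℤ) • h27 + (-23332:ℤ) • h28 + (-966:ℤ) • h29 + (3036:ℤ) • h30 + (7766:ℤ) • h31 + (3018:ℤ) • h32 + (3600:ℤ) • h33 + (-11542:ℤ) • h34 + (2836:ℤ) • h35 + (-5600:ℤ) • h36 + (4800:ℤ) • h37 + (-1998:ℤ) • h38 + (-1440:ℤ) • h39 + (-6378:ℤ) • h40 + (7284:ℤ) • h41 + (-2994:ℤ) • h42 + (9416:ℤ) • h43 + (1566:ℤ) • h44 + (960:ℤ) • h45 + (890:ℤ) • h46 + (-1962:ℤ) • h47 + (-7846:ℤ) • h48 + (2408:ℤ) • h49 + (-2720:ℤ) • h50 + (4552:ℤ) • h51 + (-1644:ℤ) • h52 + (5048:ℤ) • h53 + (2028:ℤ) • h54 + (7344:ℤ) • h55 + (11100:ℤ) • h56 + (-1962:ℤ) • h57 + (65604:ℤ) • h58 + (-6060:ℤ) • h59 + (-792:ℤ) • h60 + (-12960:ℤ) • h61 + (9366:ℤ) • h62 + (-3286:ℤ)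 • h63 + (-15906:ℤ) • h64 + (2430:ℤ) • h65 + (3096:ℤ) • h66 + (-7632:ℤ) • h67 + (210:ℤ) • h68 + (-15578:ℤ) • h69 + (5040:ℤ) • h70 + (13496:ℤ) • h71 + (2400:ℤ) • h72 + (-12216:ℤ) • h73 + (-480:ℤ) • h74 + (-2804:ℤ) • h75 + (1492:ℤ) • h76 + (-2268:ℤ) • h77 + (2908:ℤ) • h78 + (160:ℤ) • h79 + (12208:ℤ) • h80 + (-1848:ℤ) • h81 + (-14424:ℤ) • h82 + (3384:ℤ) • h83 + (1672:ℤ) • h84 + (-9784:ℤ) • h85 + (-876:ℤ) • h86 + (3432:ℤ) • h87 + (320:ℤ) • h88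

section prelim
variable {A : Type*} [NonUnitalNonAssocRing A]

theorem lin_J (hcomm : ∀ a b : A, a * b = b * a) (c2 : ∀ a : A, (2:ℤ) • a = 0 → a = 0)
    (hx4 : ∀ x : A, x * (x * (x * x)) = 0) (a b c d : A) :
    a * (b * (c * d)) + a * (c * (b * d)) + b * (a * (c * d)) + b * (c * (a * d))
      + c * (a * (b * d)) + c * (b * (a * d))
      + a * ((b * c) * d) + b * ((a * c) * d) + c * ((a * b) * d)
      + (a * (b * c)) * d + (b * (a * c)) * d + (c * (a * b)) * d = 0 := by
  apply c2
  have e : ∀ p q r s : A,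
      p * (q * (r * s)) = p * (q * (s * r)) := fun p q r s => by rw [hcomm r s]
  have h := hx4 (a + b + c + d)
  have h1 := hx4 (a + b + c)
  have h2 := hx4 (a + b + d)
  have h3 := hx4 (a + c + d)
  have h4 := hx4 (b + c + d)
  have h5 := hx4 (a + b)
  have h6 := hx4 (a + c)
  have h7 := hx4 (a + d)
  have h8 := hx4 (b + c)
  have h9 := hx4 (b + d)
  have h10 := hx4 (c + d)
  have k1 := hx4 a
  have k2 := hx4 b
  have k3 := hx4 c
  have k4 := hx4 d
  rw [hcomm (b * c) d, hcomm (a * c) d, hcomm (a * b) d, hcomm (a * (b * c)) d,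
    hcomm (b * (a * c)) d, hcomm (c * (a * b)) d]
  simp only [mul_add, add_mul] at h h1 h2 h3 h4 h5 h6 h7 h8 h9 h10
  simp only [hcomm b a, hcomm c a, hcomm d a, hcomm c b, hcomm d b, hcomm d c] at *
  linear_combination (norm := module) h - h1 - h2 - h3 - h4 + h5 + h6 + h7 + h8 + h9 + h10 - k1 - k2 - k3 - k4

theorem main_aux (c2 : ∀ a : A, (2:ℤ) • a = 0 → a = 0) (c3 : ∀ a : A, (3:ℤ) • a = 0 → a = 0)
    (hcomm : ∀ a b : A, a * b = b * a)
    (J : ∀ a b c d : A, a * (b * (c * d)) + a * (c * (b * d)) + b * (a * (c * d))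
      + b * (c * (a * d)) + c * (a * (b * d)) + c * (b * (a * d))
      + a * ((b * c) * d) + b * ((a * c) * d) + c * ((a * b) * d)
      + (a * (b * c)) * d + (b * (a * c)) * d + (c * (a * b)) * d = 0)
    (x s t f g k : A) (hs : x * x = s) (ht : x * s = t) (h0 : x * t = 0) (hf : s * s = f)
    (hg : x * f = g) (hk : x * g = k) (y : A) :
    x * (x * (x * (x * (x * (x * (x * (x * (s * y)))))))) = 0 := by
  have X3 : ∀ z, t * z = -(x * (s * z)) - (2:ℤ) • (x * (x * (x * z))) := by
    intro z
    have h := J x x x z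
    simp only [hs, ht] at h
    rw [← sub_eq_zero]
    apply c3
    linear_combination (norm := module) h
  have st : s * t = -g := by
    rw [hcomm, X3, hf, hg, ht, h0]; simp
  have ts : t * s = -g := by rw [hcomm, st]
  have tt : t * t = k := by
    rw [X3, st, h0]; simp [hk]
  have X4 : ∀ z, f * z = (4:ℤ) • (x * (x * (x * (x * z)))) - s * (s * z)
      - (2:ℤ) • (x * (s * (x * z))) - (2:ℤ) • (s * (x * (x * z))) := by
    intro z
    have h := J x x s z
    simp only [hs, ht, hf, h0, zero_mul] at h
    simp only [X3, mul_sub, mul_neg, mul_smul_comm] at h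
    linear_combination (norm := module) h
  have fs : f * s = k := by
    have h := X4 s
    simp only [ht, h0, hf, st, mul_zero, smul_zero, mul_neg, hk, hcomm s f] at h
    rw [← sub_eq_zero]
    apply c2
    linear_combination (norm := module) h
  have sf : s * f = k := by rw [hcomm, fs]
  have tf : t * f = (-3:ℤ) • (x * k) := by
    rw [X3, sf, hg, hk]; module
  have ft : f * t = (-3:ℤ) • (x * k) := by rw [hcomm, tf]
  have sg : s * g = (-3:ℤ) • (x * k) := by
    have h := X4 t
    simp only [ft, h0, st, mul_zero, smul_zero, mul_neg] at h
    rw [h]; module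
  have X5 : ∀ z, g * z = -(x * (s * (s * z))) - (4:ℤ) • (x * (x * (x * (s * z))))
      - (12:ℤ) • (x * (x * (x * (x * (x * z))))) - (2:ℤ) • (x * (x * (s * (x * z))))
      - (2:ℤ) • (x * (s * (x * (x * z)))) := by
    intro z
    have h := J x x t z
    simp only [hs, h0, ts, mul_zero, zero_mul, neg_mul] at h
    simp only [X3, mul_sub, mul_neg, mul_smul_comm] at h
    linear_combination (norm := module) -h
  have r122 : ∀ z, (16:ℤ) • (x * (x * (x * (x * (x * z))))) + (-4:ℤ) • (s * (x * (x * (x * z)))) + (4:ℤ) • (x * (x * (x * (s * z)))) + (2:ℤ) • (x * (s * (s * z))) + (2:ℤ) • (s * (s * (x * z))) = 0 := by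
    intro z
    have h := J x s s z
    simp only [hf, ht, hg, st, neg_mul] at h
    simp only [X3, X4, X5, mul_sub, mul_add, mul_neg, mul_smul_comm] at h
    linear_combination (norm := module) h
  have xk : x * k = 0 := by
    have h := r122 s
    simp only [ht, h0, hf, hg, hk, sf, st, sg, mul_zero, smul_zero, mul_neg] at h
    apply c3; apply c2; apply c2
    linear_combination (norm := module) h
  have X6 : ∀ z, k * z = (-4:ℤ) • (s * (x * (x * (x * (x * z)))))
      + (2:ℤ) • (s * (x * (s * (x * z)))) + (2:ℤ) • (s * (s * (x * (x * z))))
      - s * (s * (s * z)) := by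
    intro z
    have h := J s s s z
    simp only [hf, sf] at h
    simp only [X4, mul_sub, mul_neg, mul_smul_comm] at h
    rw [← sub_eq_zero]
    apply c3
    linear_combination (norm := module) h
  have r123 : ∀ z, (2:ℤ) • (x * (x * (x * (x * (s * z))))) + (16:ℤ) • (x * (x * (x * (x * (x * (x * z)))))) + (2:ℤ) • (x * (x * (s * (x * (x * z))))) + (-1:ℤ) • (s * (x * (x * (s * z)))) + (-4:ℤ) • (s * (x * (x * (x * (x * z))))) + (-1:ℤ) • (s * (x * (s * (x * z)))) + (-1:ℤ) • (x * (s * (x * (s * z)))) + (-1:ℤ) • (x * (s * (s * (x * z)))) = 0 := by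
    intro z
    have h := J x s t z
    simp only [hs, ht, h0, hf, hg, hk, st, ts, tt, fs, sf, tf, ft, sg, xk, mul_zero, zero_mul,
      smul_zero, mul_neg, neg_mul] at h
    simp only [X3, X4, X5, X6, mul_sub, mul_add, mul_neg, mul_smul_comm] at h
    linear_combination (norm := module) h
  have r114 : ∀ z, (-16:ℤ) • (s * (x * (x * (x * (x * z))))) + (6:ℤ) • (s * (x * (s * (x * z)))) + (4:ℤ) • (s * (s * (x * (x * z)))) + (-4:ℤ) • (s * (s * (s * z))) + (-4:ℤ) • (x * (x * (s * (s * z)))) + (-4:ℤ) • (x * (x * (x * (x * (s * z))))) + (-8:ℤ) • (x * (x * (x * (s * (x * z))))) + (-12:ℤ) • (x * (x * (s * (x * (x * z))))) + (-2:ℤ) • (x * (s * (x * (s * z)))) + (-2:ℤ) • (s * (x * (x * (s * z)))) + (-2:ℤ) • (x * (s * (s * (x * z)))) + (-8:ℤ) • (x * (s * (x * (x * (x * z))))) = 0 := by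
    intro z
    have h := J x x f z
    simp only [hs, ht, h0, hf, hg, hk, st, ts, tt, fs, sf, tf, ft, sg, xk, mul_zero, zero_mul,
      smul_zero, mul_neg, neg_mul] at h
    simp only [X3, X4, X5, X6, mul_sub, mul_add, mul_neg, mul_smul_comm] at h
    linear_combination (norm := module) h
  have r133 : ∀ z, (4:ℤ) • (x * (s * (x * (s * (x * z))))) + (2:ℤ) • (x * (s * (s * (x * (x * z))))) + (-1:ℤ) • (x * (s * (s * (s * z)))) + (2:ℤ) • (x * (x * (s * (x * (s * z))))) + (4:ℤ) • (x * (x * (s * (x * (x * (x * z)))))) + (8:ℤ) • (x * (x * (x * (x * (x * (s * z)))))) + (24:ℤ) • (x * (x * (x * (x * (x * (x * (x * z))))))) + (2:ℤ) • (x * (s * (x * (x * (s * z))))) + (4:ℤ) • (x * (x * (x * (x * (s * (x * z)))))) + (4:ℤ) • (x * (s * (x * (x * (x * (x * z)))))) = 0 := by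
    intro z
    have h := J x t t z
    simp only [hs, ht, h0, hf, hg, hk, st, ts, tt, fs, sf, tf, ft, sg, xk, mul_zero, zero_mul,
      smul_zero, mul_neg, neg_mul] at h
    simp only [X3, X4, X5, X6, mul_sub, mul_add, mul_neg, mul_smul_comm] at h
    linear_combination (norm := module) h
  have r124 : ∀ z, (-3:ℤ) • (x * (s * (s * (s * z)))) + (-2:ℤ) • (s * (x * (s * (s * z)))) + (-4:ℤ) • (s * (x * (x * (x * (s * z))))) + (-6:ℤ) • (s * (x * (x * (s * (x * z))))) + (-6:ℤ) • (s * (x * (s * (x * (x * z))))) + (-8:ℤ) • (x * (x * (x * (x * (x * (x * (x * z))))))) + (4:ℤ) • (x * (s * (x * (x * (x * (x * z)))))) + (-2:ℤ) • (x * (x * (s * (x * (s * z))))) + (-2:ℤ) • (s * (s * (s * (x * z)))) + (4:ℤ) • (x * (x * (x * (x * (x * (s * z)))))) + (-2:ℤ) • (x * (s * (x * (x * (s * z))))) + (4:ℤ) • (x * (x * (x * (x * (s * (x * z)))))) + (-2:ℤ) • (x * (s * (x * (s * (x * z))))) = 0 := by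
    intro z
    have h := J x s f z
    simp only [hs, ht, h0, hf, hg, hk, st, ts, tt, fs, sf, tf, ft, sg, xk, mul_zero, zero_mul,
      smul_zero, mul_neg, neg_mul] at h
    simp only [X3, X4, X5, X6, mul_sub, mul_add, mul_neg, mul_smul_comm] at h
    linear_combination (norm := module) h
  have h := cert_LU (AddMonoidHom.mulLeft x) (AddMonoidHom.mulLeft s) r122 r123 r114 r133 r124 y
  simp only [AddMonoidHom.coe_mulLeft] at h
  apply c2; apply c2; apply c2; apply c2; apply c2; apply c2; apply c2; apply c2; apply c2; apply c3
  simp only [smul_smul]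
  exact h

end prelim

/-- 𝔄 is a commutative (not necessarily associative) algebra over a field `F` of
characteristic ≠ 2, 3, satisfying the identity `x⁴ = 0` (principal powers:
`x¹ = x`, `x^(k+1) = x * x^k`). -/
theorem stmt_13 {F A : Type*} [Field F] [NonUnitalNonAssocRing A]
    [Module F A] [SMulCommClass F A A] [IsScalarTower F A A]
    (hcomm : ∀ a b : A, a * b = b * a)
    (h2 : (2 : F) ≠ 0) (h3 : (3 : F) ≠ 0)
    (hx4 : ∀ x : A, x * (x * (x * x)) = 0)
    (x y : A) :
    x * (x * (x * (x * (x * (x * (x * (x * (x * x * (y))))))))) = 0 := by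
  have c2 : ∀ a : A, (2:ℤ) • a = 0 → a = 0 := by
    intro a h
    have h' : (2:F) • a = 0 := by
      rw [← h]; module
    exact (smul_eq_zero.mp h').resolve_left h2
  have c3 : ∀ a : A, (3:ℤ) • a = 0 → a = 0 := by
    intro a h
    have h' : (3:F) • a = 0 := by
      rw [← h]; module
    exact (smul_eq_zero.mp h').resolve_left h3
  exact main_aux c2 c3 hcomm (lin_J hcomm c2 hx4) x (x * x) (x * (x * x)) (x * x * (x * x)) _ _
    rfl rfl (hx4 x) rfl rfl rfl y
end

section
/- For every a ∈ 𝔄 one has L_a^9 = 0; that is, for all a, b ∈ 𝔄, applying left multiplication by a nine times to b gives a·(a·(a·(a·(a·(a·(a·(a·(a·b)))))))) = 0. -/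
set_option linter.unusedSimpArgs false

theorem aux_cert {E : Type*} [Ring E] (x y : E)
    (f114 : - 4*(x*x*x*x*y) - 8*(x*x*x*y*x) - 12*(x*x*y*x*x) - 4*(x*x*y*y) - 8*(x*y*x*x*x) - 2*(x*y*x*y) - 2*(x*y*y*x) - 4*(y*x*x*x*x) - 2*(y*x*x*y) - 2*(y*y*x*x) - (y*y*y) = 0)
    (f115 : - 72*(x*x*x*x*x*x*x) - 20*(x*x*x*x*x*y) - 12*(x*x*x*x*y*x) - 16*(x*x*x*y*x*x) - 6*(x*x*x*y*y) - 8*(x*x*y*x*x*x) - 2*(x*x*y*x*y) - 2*(x*x*y*y*x) - 4*(x*y*x*x*x*x) - 2*(x*y*x*x*y) - 2*(x*y*y*x*x) - (x*y*y*y) = 0)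
    (f122 : 16*(x*x*x*x*x) + 4*(x*x*x*y) + 2*(x*y*y) - 4*(y*x*x*x) + 2*(y*y*x) = 0)
    (f123 : 16*(x*x*x*x*x*x) + 2*(x*x*x*x*y) + 2*(x*x*y*x*x) - (x*y*x*y) - (x*y*y*x) - 4*(y*x*x*x*x) - (y*x*x*y) - (y*x*y*x) = 0)
    (f222 : 4*(y*x*x*x*x) - 2*(y*x*y*x) - 2*(y*y*x*x) + (y*y*y) = 0)
    : 512 * (x*x*x*x*x*x*x*x*x) = 0 := by
  obtain ⟨p114, e114⟩ : ∃ p, p = - 4*(x*x*x*x*y) - 8*(x*x*x*y*x) - 12*(x*x*y*x*x) - 4*(x*x*y*y) - 8*(x*y*x*x*x) - 2*(x*y*x*y) - 2*(x*y*y*x) - 4*(y*x*x*x*x) - 2*(y*x*x*y) - 2*(y*y*x*x) - (y*y*y) := ⟨_, rfl⟩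
  obtain ⟨p115, e115⟩ : ∃ p, p = - 72*(x*x*x*x*x*x*x) - 20*(x*x*x*x*x*y) - 12*(x*x*x*x*y*x) - 16*(x*x*x*y*x*x) - 6*(x*x*x*y*y) - 8*(x*x*y*x*x*x) - 2*(x*x*y*x*y) - 2*(x*x*y*y*x) - 4*(x*y*x*x*x*x) - 2*(x*y*x*x*y) - 2*(x*y*y*x*x) - (x*y*y*y) := ⟨_, rfl⟩
  obtain ⟨p122, e122⟩ : ∃ p, p = 16*(x*x*x*x*x) + 4*(x*x*x*y) + 2*(x*y*y) - 4*(y*x*x*x) + 2*(y*y*x) := ⟨_, rfl⟩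
  obtain ⟨p123, e123⟩ : ∃ p, p = 16*(x*x*x*x*x*x) + 2*(x*x*x*x*y) + 2*(x*x*y*x*x) - (x*y*x*y) - (x*y*y*x) - 4*(y*x*x*x*x) - (y*x*x*y) - (y*x*y*x) := ⟨_, rfl⟩
  obtain ⟨p222, e222⟩ : ∃ p, p = 4*(y*x*x*x*x) - 2*(y*x*y*x) - 2*(y*y*x*x) + (y*y*y) := ⟨_, rfl⟩
  rw [← e114] at f114
  rw [← e115] at f115
  rw [← e122] at f122
  rw [← e123] at f123
  rw [← e222] at f222
  have key : 512 * (x*x*x*x*x*x*x*x*x) =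
      (12) * (p114 * (x*x*x)) +
      (3) * (p114 * (x*y)) +
      (3) * (p114 * (y*x)) +
      (-14) * (x * p114 * (x*x)) +
      (-5) * (x * p114 * (y)) +
      (6) * (x*x * p114 * (x)) +
      (4) * (x*y * p114) +
      (3) * (y*x * p114) +
      (-4) * (p115 * (y)) +
      (-24) * (x * p115 * (x)) +
      (8) * (x*x * p115) +
      (-6) * (p122 * (x*x*y)) +
      (6) * (p122 * (x*y*x)) +
      (-12) * (p122 * (y*x*x)) +
      (-6) * (p122 * (y*y)) +
      (-20) * (x * p122 * (x*x*x)) +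
      (-14) * (x * p122 * (y*x)) +
      (8) * (x*x * p122 * (x*x)) +
      (-6) * (x*x * p122 * (y)) +
      (-28) * (x*x*x * p122 * (x)) +
      (6) * (y*x * p122 * (x)) +
      (40) * (x*x*x*x * p122) +
      (-12) * (x*x*y * p122) +
      (-4) * (x*y*x * p122) +
      (-6) * (y*x*x * p122) +
      (6) * (y*y * p122) +
      (-24) * (p123 * (x*x*x)) +
      (-6) * (p123 * (x*y)) +
      (-6) * (p123 * (y*x)) +
      (-52) * (x * p123 * (x*x)) +
      (-6) * (x * p123 * (y)) +
      (-12) * (x*x * p123 * (x)) +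
      (48) * (x*x*x * p123) +
      (-16) * (x*y * p123) +
      (-6) * (y*x * p123) +
      (12) * (p222 * (x*x*x)) +
      (3) * (p222 * (x*y)) +
      (3) * (p222 * (y*x)) +
      (18) * (x * p222 * (x*x)) +
      (7) * (x * p222 * (y)) +
      (46) * (x*x * p222 * (x)) +
      (-12) * (y * p222 * (x)) +
      (3) * (y*x * p222) := by
    rw [e114, e115, e122, e123, e222]
    noncomm_ring
  rw [key, f114, f115, f122, f123, f222]
  simp only [mul_zero, zero_mul, add_zero]

theorem aux_ops {E : Type*} [Ring E] (x y z t s : E)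
    (f111 : 2*(x*x*x) + (x*y) + (z) = 0)
    (f112 : 2*(x*x*y) + 2*(x*y*x) + 2*(x*z) + 2*(y*x*x) + (y*y) + (t) = 0)
    (f113 : 2*(x*x*z) + 2*(x*z*x) + 2*(z*x*x) + (z*y) - (s) = 0)
    (f114 : 2*(x*x*t) + 2*(x*t*x) + 2*(x*s) + 2*(t*x*x) + (t*y) = 0)
    (f115 : 2*(x*x*s) + 2*(x*s*x) + 2*(s*x*x) + (s*y) = 0)
    (f122 : 2*(x*y*y) + (x*t) + 2*(y*x*y) + 2*(y*y*x) + 2*(y*z) - (s) = 0)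
    (f123 : (x*y*z) + (x*z*y) - (x*s) + (y*x*z) + (y*z*x) + (z*x*y) + (z*y*x) + (z*z) = 0)
    (f222 : 2*(y*y*y) + (y*t) = 0)
    : 512 * (x*x*x*x*x*x*x*x*x) = 0 := by
  have hz : z = - 2*(x*x*x) - (x*y) := by
    rw [← sub_eq_zero, ← f111]; noncomm_ring
  subst hz
  have ht : t = 4*(x*x*x*x) - 2*(x*y*x) - 2*(y*x*x) - (y*y) := by
    rw [← sub_eq_zero, ← f112]; noncomm_ring
  subst ht
  have hs : s = - 12*(x*x*x*x*x) - 4*(x*x*x*y) - 2*(x*x*y*x) - 2*(x*y*x*x) - (x*y*y) := by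
    rw [eq_comm, ← sub_eq_zero, ← f113]; noncomm_ring
  subst hs
  apply aux_cert x y
  · rw [← f114]; noncomm_ring
  · rw [← f115]; noncomm_ring
  · rw [← f122]; noncomm_ring
  · rw [← f123]; noncomm_ring
  · rw [← f222]; noncomm_ring


/-- The full linearization of `x⁴ = 0`. -/
theorem aux_lin {F A : Type*} [Field F] [NonUnitalNonAssocRing A] [Module F A]
    (hcomm : ∀ a b : A, a * b = b * a) (h2 : (2 : F) ≠ 0)
    (hx4 : ∀ x : A, x * (x * (x * x)) = 0) (u v w b : A) :
    u * (v * (w * b)) + u * (w * (v * b)) + v * (u * (w * b)) + v * (w * (u * b))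
      + w * (u * (v * b)) + w * (v * (u * b))
      + u * ((v * w) * b) + v * ((u * w) * b) + w * ((u * v) * b)
      + (u * (v * w)) * b + (v * (u * w)) * b + (w * (u * v)) * b = 0 := by
  have two : ∀ q : A, q + q = 0 → q = 0 := by
    intro q hq
    have : (2 : F) • q = 0 := by rw [two_smul, hq]
    exact (smul_eq_zero.mp this).resolve_left h2
  apply two
  rw [hcomm (v * w) b, hcomm (u * w) b, hcomm (u * v) b, hcomm (u * (v * w)) b,
    hcomm (v * (u * w)) b, hcomm (w * (u * v)) b]
  have e1 := hx4 u
  have e2 := hx4 v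
  have e3 := hx4 w
  have e4 := hx4 b
  have e12 := hx4 (u + v)
  have e13 := hx4 (u + w)
  have e14 := hx4 (u + b)
  have e23 := hx4 (v + w)
  have e24 := hx4 (v + b)
  have e34 := hx4 (w + b)
  have e123 := hx4 (u + v + w)
  have e124 := hx4 (u + v + b)
  have e134 := hx4 (u + w + b)
  have e234 := hx4 (v + w + b)
  have e := hx4 (u + v + w + b)
  have key : (u + v + w + b) * ((u + v + w + b) * ((u + v + w + b) * (u + v + w + b)))
      - (u + v + w) * ((u + v + w) * ((u + v + w) * (u + v + w)))
      - (u + v + b) * ((u + v + b) * ((u + v + b) * (u + v + b)))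
      - (u + w + b) * ((u + w + b) * ((u + w + b) * (u + w + b)))
      - (v + w + b) * ((v + w + b) * ((v + w + b) * (v + w + b)))
      + (u + v) * ((u + v) * ((u + v) * (u + v)))
      + (u + w) * ((u + w) * ((u + w) * (u + w)))
      + (u + b) * ((u + b) * ((u + b) * (u + b)))
      + (v + w) * ((v + w) * ((v + w) * (v + w)))
      + (v + b) * ((v + b) * ((v + b) * (v + b)))
      + (w + b) * ((w + b) * ((w + b) * (w + b)))
      - u * (u * (u * u)) - v * (v * (v * v)) - w * (w * (w * w)) - b * (b * (b * b)) = 0 := by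
    rw [e1, e2, e3, e4, e12, e13, e14, e23, e24, e34, e123, e124, e134, e234, e]
    simp
  rw [← key]
  simp only [mul_add, add_mul, hcomm v u, hcomm w u, hcomm w v, hcomm b u, hcomm b v, hcomm b w]
  abel

theorem stmt_19 {F A : Type*} [Field F] [NonUnitalNonAssocRing A]
    [Module F A] [SMulCommClass F A A] [IsScalarTower F A A]
    (hcomm : ∀ a b : A, a * b = b * a)
    (h2 : (2 : F) ≠ 0) (h3 : (3 : F) ≠ 0) (h5 : (5 : F) ≠ 0)
    (hx4 : ∀ x : A, x * (x * (x * x)) = 0)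
    (hx6 : ∀ x : A, x * (x * ((x * x) * (x * x))) = 0)
    (a b : A) :
    a * (a * (a * (a * (a * (a * (a * (a * (a * (b))))))))) = 0 := by
  have lin := aux_lin hcomm h2 hx4
  have cancel2 : ∀ q : A, (2 : F) • q = 0 → q = 0 := fun q hq =>
    (smul_eq_zero.mp hq).resolve_left h2
  have cancel3 : ∀ q : A, (3 : F) • q = 0 → q = 0 := fun q hq =>
    (smul_eq_zero.mp hq).resolve_left h3
  obtain ⟨a2, m11⟩ : ∃ c, a * a = c := ⟨_, rfl⟩
  obtain ⟨a3, m12⟩ : ∃ c, a * a2 = c := ⟨_, rfl⟩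
  obtain ⟨t, m22⟩ : ∃ c, a2 * a2 = c := ⟨_, rfl⟩
  obtain ⟨s, m14⟩ : ∃ c, a * t = c := ⟨_, rfl⟩
  have m21 : a2 * a = a3 := by rw [hcomm, m12]
  have m41 : t * a = s := by rw [hcomm, m14]
  have m13 : a * a3 = 0 := by have := hx4 a; rwa [m11, m12] at this
  have m31 : a3 * a = 0 := by rw [hcomm, m13]
  have m15 : a * s = 0 := by have := hx6 a; rwa [m11, m22, m14] at this
  have m51 : s * a = 0 := by rw [hcomm, m15]
  have m23 : a2 * a3 = -s := by
    have h := lin a a a a2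
    simp only [m11, m12, m13, m21, m22, m31, m14, hcomm a3 a2, mul_zero, zero_mul] at h
    rw [← add_eq_zero_iff_eq_neg]
    apply cancel3
    rw [← h]
    module
  have m32 : a3 * a2 = -s := by rw [hcomm, m23]
  have m33 : a3 * a3 = 0 := by
    have h := lin a a a a3
    simp only [m11, m12, m13, m21, m22, m31, m14, m23, m32, m15, mul_zero, zero_mul, mul_neg, neg_mul] at h
    apply cancel3
    rw [← h]
    module
  have m24 : a2 * t = 0 := by
    have h := lin a a a2 a2
    simp only [m11, m12, m13, m21, m22, m31, m14, m41, m23, m32, m15, m33, hcomm t a2, mul_zero, zero_mul, mul_neg, neg_mul] at h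
    apply cancel2
    rw [← h]
    module
  have m42 : t * a2 = 0 := by rw [hcomm, m24]
  have m25 : a2 * s = 0 := by
    have h := lin a a2 a2 a2
    simp only [m11, m12, m13, m21, m22, m31, m14, m41, m23, m32, m15, m33, m24, m42, hcomm s a2, hcomm t a3, mul_zero, zero_mul, mul_neg, neg_mul] at h
    apply cancel3
    rw [← neg_eq_zero, ← h]
    module
  have m52 : s * a2 = 0 := by rw [hcomm, m25]
  have hfin := aux_ops (LinearMap.mulLeft F a) (LinearMap.mulLeft F a2)
    (LinearMap.mulLeft F a3) (LinearMap.mulLeft F t) (LinearMap.mulLeft F s) ?_ ?_ ?_ ?_ ?_ ?_ ?_ ?_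
  · have h := LinearMap.congr_fun hfin b
    have h' : (512 : F) • (a * (a * (a * (a * (a * (a * (a * (a * (a * (b)))))))))) = 0 := by
      simpa [ofNat_smul_eq_nsmul] using h
    have h512 : (512 : F) ≠ 0 := by
      have : (512 : F) = 2 ^ 9 := by norm_num
      rw [this]
      exact pow_ne_zero _ h2
    exact (smul_eq_zero.mp h').resolve_left h512
  · ext v
    have h := lin a a a v
    simp only [m11, m12, m13, m14, m15, m21, m22, m23, m24, m25, m31, m32, m33, m41, m42, m51, m52, zero_mul, mul_zero, neg_mul, mul_neg, neg_zero] at h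
    apply cancel3
    simp only [LinearMap.add_apply, LinearMap.sub_apply, LinearMap.zero_apply, two_mul,
      Module.End.mul_apply, LinearMap.mulLeft_apply]
    rw [← h]
    module
  · ext v
    have h := lin a a a2 v
    simp only [m11, m12, m13, m14, m15, m21, m22, m23, m24, m25, m31, m32, m33, m41, m42, m51, m52, zero_mul, mul_zero, neg_mul, mul_neg, neg_zero] at h
    simp only [LinearMap.add_apply, LinearMap.sub_apply, LinearMap.zero_apply, two_mul,
      Module.End.mul_apply, LinearMap.mulLeft_apply]
    rw [← h]
    module
  · ext v
    have h := lin a a a3 v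
    simp only [m11, m12, m13, m14, m15, m21, m22, m23, m24, m25, m31, m32, m33, m41, m42, m51, m52, zero_mul, mul_zero, neg_mul, mul_neg, neg_zero] at h
    simp only [LinearMap.add_apply, LinearMap.sub_apply, LinearMap.zero_apply, two_mul,
      Module.End.mul_apply, LinearMap.mulLeft_apply]
    rw [← h]
    module
  · ext v
    have h := lin a a t v
    simp only [m11, m12, m13, m14, m15, m21, m22, m23, m24, m25, m31, m32, m33, m41, m42, m51, m52, zero_mul, mul_zero, neg_mul, mul_neg, neg_zero] at h
    simp only [LinearMap.add_apply, LinearMap.sub_apply, LinearMap.zero_apply, two_mul,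
      Module.End.mul_apply, LinearMap.mulLeft_apply]
    rw [← h]
    module
  · ext v
    have h := lin a a s v
    simp only [m11, m12, m13, m14, m15, m21, m22, m23, m24, m25, m31, m32, m33, m41, m42, m51, m52, zero_mul, mul_zero, neg_mul, mul_neg, neg_zero] at h
    simp only [LinearMap.add_apply, LinearMap.sub_apply, LinearMap.zero_apply, two_mul,
      Module.End.mul_apply, LinearMap.mulLeft_apply]
    rw [← h]
    module
  · ext v
    have h := lin a a2 a2 v
    simp only [m11, m12, m13, m14, m15, m21, m22, m23, m24, m25, m31, m32, m33, m41, m42, m51, m52, zero_mul, mul_zero, neg_mul, mul_neg, neg_zero] at h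
    simp only [LinearMap.add_apply, LinearMap.sub_apply, LinearMap.zero_apply, two_mul,
      Module.End.mul_apply, LinearMap.mulLeft_apply]
    rw [← h]
    module
  · ext v
    have h := lin a a2 a3 v
    simp only [m11, m12, m13, m14, m15, m21, m22, m23, m24, m25, m31, m32, m33, m41, m42, m51, m52, zero_mul, mul_zero, neg_mul, mul_neg, neg_zero] at h
    simp only [LinearMap.add_apply, LinearMap.sub_apply, LinearMap.zero_apply, two_mul,
      Module.End.mul_apply, LinearMap.mulLeft_apply]
    rw [← h]
    module
  · ext v
    have h := lin a2 a2 a2 v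
    simp only [m11, m12, m13, m14, m15, m21, m22, m23, m24, m25, m31, m32, m33, m41, m42, m51, m52, zero_mul, mul_zero, neg_mul, mul_neg, neg_zero] at h
    apply cancel3
    simp only [LinearMap.add_apply, LinearMap.sub_apply, LinearMap.zero_apply, two_mul,
      Module.End.mul_apply, LinearMap.mulLeft_apply]
    rw [← h]
    module
end
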